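/- Let γ be a smooth closed strictly convex curve and for 0 ≤ r ≤ r_in let L_Q(r) denote the Minkowski length of the inner parallel set boundary C_r at distance r. Then the area enclosed by γ satisfies A = ∫₀^{r_in} L_Q(r) dr. -/

import Mathlib

open Real Set MeasureTheory

noncomputable section

def det2 (u v : ℝ × ℝ) : ℝ := u.1 * v.2 - u.2 * v.1

def er (θ : ℝ) : ℝ × ℝ := (Real.cos θ, Real.sin θ)

def eth (θ : ℝ) : ℝ × ℝ := (-Real.sin θ, Real.cos θ)

section part0
open Filter Topology

def dt (x : ℝ × ℝ) (θ : ℝ) : ℝ := x.1 * cos θ + x.2 * sin θ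

def Supp (E : Set (ℝ × ℝ)) (h : ℝ → ℝ) : Prop :=
  ∀ θ, (∃ x ∈ E, dt x θ = h θ) ∧ ∀ x ∈ E, dt x θ ≤ h θ

def sd (ε : ℝ) (h : ℝ → ℝ) (θ : ℝ) : ℝ := h (θ + ε) + h (θ - ε) - 2 * cos ε * h θ

def BB (ε : ℝ) (f h : ℝ → ℝ) : ℝ := ∫ θ in (0:ℝ)..2 * π, f θ * sd ε h θ

def Wu (k : ℝ → ℝ) : Set (ℝ × ℝ) := {x | ∀ θ, dt x θ ≤ k θ}

def Bd (R : ℝ) (E : Set (ℝ × ℝ)) : Prop := ∀ x ∈ E, |x.1| ≤ R ∧ |x.2| ≤ R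

lemma abs_cos_sub (x y : ℝ) : |cos x - cos y| ≤ |x - y| := by
  have := Convex.norm_image_sub_le_of_norm_deriv_le (f := cos) (C := 1) (s := univ) (x := y) (y := x)
    (fun _ _ => Real.differentiable_cos.differentiableAt) 
    (fun z _ => by simp [abs_sin_le_one]) convex_univ trivial trivial
  simpa using this

lemma abs_sin_sub (x y : ℝ) : |sin x - sin y| ≤ |x - y| := by
  have := Convex.norm_image_sub_le_of_norm_deriv_le (f := sin) (C := 1) (s := univ) (x := y) (y := x)
    (fun _ _ => Real.differentiable_sin.differentiableAt) 
    (fun z _ => by simp [abs_cos_le_one]) convex_univ trivial trivial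
  simpa using this

lemma dt_add (x y : ℝ × ℝ) (θ : ℝ) : dt (x + y) θ = dt x θ + dt y θ := by
  simp [dt]; ring
lemma dt_sub (x y : ℝ × ℝ) (θ : ℝ) : dt (x - y) θ = dt x θ - dt y θ := by
  simp [dt]; ring
lemma dt_smul (c : ℝ) (y : ℝ × ℝ) (θ : ℝ) : dt (c • y) θ = c * dt y θ := by
  simp [dt]; ring
lemma dt_pi (y : ℝ × ℝ) (θ : ℝ) : dt y (θ + π) = - dt y θ := by
  simp [dt, cos_add_pi, sin_add_pi]; ring
lemma dt_per (x : ℝ × ℝ) : Function.Periodic (dt x) (2 * π) := by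
  intro θ; simp [dt]
lemma dt_cont (x : ℝ × ℝ) : Continuous (dt x) := by unfold dt; fun_prop
lemma dt_cont' (θ : ℝ) : Continuous (fun x => dt x θ) := by unfold dt; fun_prop
lemma dt_sd (x : ℝ × ℝ) (ε θ : ℝ) : sd ε (dt x) θ = 0 := by
  simp [sd, dt, cos_add, sin_add, cos_sub, sin_sub]; ring

lemma dt_lip {R : ℝ} {x : ℝ × ℝ} (hx : |x.1| ≤ R ∧ |x.2| ≤ R) (θ ψ : ℝ) :
    |dt x θ - dt x ψ| ≤ 2 * R * |θ - ψ| := by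
  have e : dt x θ - dt x ψ = x.1 * (cos θ - cos ψ) + x.2 * (sin θ - sin ψ) := by simp [dt]; ring
  rw [e]
  refine (abs_add_le _ _).trans ?_
  rw [abs_mul, abs_mul]
  have h1 := abs_cos_sub θ ψ
  have h2 := abs_sin_sub θ ψ
  have : |x.1| * |cos θ - cos ψ| ≤ R * |θ - ψ| := by
    have := abs_nonneg x.1
    gcongr; exact this.trans hx.1; exact hx.1
  have : |x.2| * |sin θ - sin ψ| ≤ R * |θ - ψ| := by
    have := abs_nonneg x.2
    gcongr; exact this.trans hx.2; exact hx.2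
  linarith

lemma dt_bd {R : ℝ} {x : ℝ × ℝ} (hx : |x.1| ≤ R ∧ |x.2| ≤ R) (θ : ℝ) : |dt x θ| ≤ 2 * R := by
  refine (abs_add_le _ _).trans ?_
  rw [abs_mul, abs_mul]
  have h1 := abs_cos_le_one θ
  have h2 := abs_sin_le_one θ
  nlinarith [abs_nonneg x.1, abs_nonneg x.2, abs_nonneg (cos θ), abs_nonneg (sin θ)]

section supp
variable {E : Set (ℝ × ℝ)} {h : ℝ → ℝ} {R : ℝ}

lemma Supp.lip (hs : Supp E h) (hb : Bd R E) (θ ψ : ℝ) : |h θ - h ψ| ≤ 2 * R * |θ - ψ| := by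
  have key : ∀ θ ψ, h θ - h ψ ≤ 2 * R * |θ - ψ| := by
    intro θ ψ
    obtain ⟨x, hx, e⟩ := (hs θ).1
    have h1 := (hs ψ).2 x hx
    have h2 := (le_abs_self _).trans (dt_lip (hb x hx) θ ψ)
    linarith
  rw [abs_le]
  have := key ψ θ
  rw [abs_sub_comm] at this
  constructor
  · linarith
  · exact key θ ψ

lemma Supp.bd (hs : Supp E h) (hb : Bd R E) (θ : ℝ) : |h θ| ≤ 2 * R := by
  obtain ⟨x, hx, e⟩ := (hs θ).1
  rw [← e]; exact dt_bd (hb x hx) θ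

lemma Supp.per (hs : Supp E h) : Function.Periodic h (2 * π) := by
  intro θ
  obtain ⟨x, hx, e⟩ := (hs θ).1
  obtain ⟨y, hy, e'⟩ := (hs (θ + 2 * π)).1
  have h1 := (hs θ).2 y hy
  have h2 := (hs (θ + 2 * π)).2 x hx
  rw [dt_per] at e' h2
  linarith

lemma Supp.cont (hs : Supp E h) (hb : Bd R E) : Continuous h := by
  have : LipschitzWith (2 * R).toNNReal h := by
    apply LipschitzWith.of_dist_le_mul
    intro x y
    have := hs.lip hb x y
    simp only [Real.dist_eq]
    refine this.trans ?_
    gcongr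
    exact Real.le_coe_toNNReal _
  exact this.continuous

lemma Supp.sd_nonneg (hs : Supp E h) (ε θ : ℝ) : 0 ≤ sd ε h θ := by
  obtain ⟨x, hx, e⟩ := (hs θ).1
  have h1 := (hs (θ + ε)).2 x hx
  have h2 := (hs (θ - ε)).2 x hx
  have := dt_sd x ε θ
  unfold sd at this ⊢
  rw [← e]; linarith

lemma Supp.sd_le (hs : Supp E h) (hb : Bd R E) (hR : 0 ≤ R) {ε : ℝ} (hε : 0 < ε) (hε1 : ε ≤ 1) (θ : ℝ) :
    sd ε h θ ≤ 8 * R * ε := by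
  have h1 := (le_abs_self _).trans (hs.lip hb (θ + ε) θ)
  have h2 := (le_abs_self _).trans (hs.lip hb (θ - ε) θ)
  have h3 := one_sub_sq_div_two_le_cos (x := ε)
  have h4 := abs_le.1 (hs.bd hb θ)
  have h5 := cos_le_one ε
  have e1 : |θ + ε - θ| = ε := by simp [abs_of_pos hε]
  have e2 : |θ - ε - θ| = ε := by simp [abs_of_pos hε]
  rw [e1] at h1; rw [e2] at h2
  have e : sd ε h θ = (h (θ+ε) - h θ) + (h (θ - ε) - h θ) + 2 * (1 - cos ε) * h θ := by
    simp only [sd]; ring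
  rw [e]
  have : (1 - cos ε) * h θ ≤ (ε / 2) * (2 * R) := by
    have : 1 - cos ε ≤ ε / 2 := by nlinarith
    calc (1 - cos ε) * h θ ≤ (1 - cos ε) * (2 * R) := by gcongr; linarith
      _ ≤ _ := by gcongr
  nlinarith
end supp

section bil
variable {f g h : ℝ → ℝ}

lemma sd_cont (hh : Continuous h) (ε : ℝ) : Continuous (sd ε h) := by unfold sd; fun_prop

lemma BB_add_right (hf : Continuous f) (hg : Continuous g) (hh : Continuous h) (c ε : ℝ) :
    BB ε f (fun θ => g θ + c * h θ) = BB ε f g + c * BB ε f h := by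
  unfold BB
  rw [← intervalIntegral.integral_const_mul, ← intervalIntegral.integral_add]
  · congr 1; ext θ; simp only [sd]; ring
  · exact (hf.mul (sd_cont hg ε)).intervalIntegrable _ _
  · exact (continuous_const.mul (hf.mul (sd_cont hh ε))).intervalIntegrable _ _

lemma per_shift (hf : Function.Periodic f (2 * π)) (c : ℝ) :
    ∫ θ in (0:ℝ)..2 * π, f (θ + c) = ∫ θ in (0:ℝ)..2 * π, f θ := by
  rw [intervalIntegral.integral_comp_add_right]
  have := hf.intervalIntegral_add_eq (0 + c) 0
  rw [zero_add] at this ⊢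
  rw [add_comm (2 * π) c, this, zero_add]

lemma BB_symm (hf : Continuous f) (hh : Continuous h) (pf : Function.Periodic f (2 * π))
    (ph : Function.Periodic h (2 * π)) (ε : ℝ) : BB ε f h = BB ε h f := by
  have key : ∀ f h : ℝ → ℝ, Continuous f → Continuous h → Function.Periodic f (2 * π) →
      Function.Periodic h (2 * π) → BB ε f h = (∫ θ in (0:ℝ)..2 * π, f θ * h (θ + ε)) +
      (∫ θ in (0:ℝ)..2 * π, h θ * f (θ + ε)) - 2 * cos ε * ∫ θ in (0:ℝ)..2 * π, f θ * h θ := by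
    intro f h hf hh pf ph
    have e := per_shift (f := fun θ => f θ * h (θ - ε)) (fun θ => by
      show f _ * h _ = _
      rw [pf, show θ + 2 * π - ε = (θ - ε) + 2 * π by ring, ph]) ε
    simp only [add_sub_cancel_right] at e
    have e2 : ∀ θ, h θ * f (θ + ε) = f (θ + ε) * h θ := fun θ => mul_comm _ _
    simp only [e2]
    rw [e, ← intervalIntegral.integral_const_mul, ← intervalIntegral.integral_add,
      ← intervalIntegral.integral_sub]
    · unfold BB; congr 1; ext θ; simp only [sd]; ring
    all_goals exact Continuous.intervalIntegrable (by fun_prop) _ _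
  rw [key f h hf hh pf ph, key h f hh hf ph pf]
  have : ∀ θ, f θ * h θ = h θ * f θ := fun θ => mul_comm _ _
  simp only [this]; ring

lemma BB_nonneg {E : Set (ℝ × ℝ)} (hs : Supp E h) (hf : ∀ θ, 0 ≤ f θ) (ε : ℝ) : 0 ≤ BB ε f h := by
  unfold BB
  apply intervalIntegral.integral_nonneg (by positivity)
  intro θ _
  exact mul_nonneg (hf θ) (hs.sd_nonneg ε θ)

lemma BB_self_le (hf : Continuous f) (pf : Function.Periodic f (2 * π)) (ε : ℝ) :
    BB ε f f ≤ ε ^ 2 * ∫ θ in (0:ℝ)..2 * π, f θ ^ 2 := by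
  have psq : Function.Periodic (fun θ => f θ ^ 2) (2 * π) := fun θ => by simp only [pf θ]
  have e1 := per_shift psq ε
  have e2 := per_shift psq (-ε)
  have : BB ε f f ≤ ∫ θ in (0:ℝ)..2 * π, ((1/2) * f (θ + ε) ^ 2 + (1/2) * f (θ + -ε) ^ 2 +
      (ε ^ 2 - 1) * f θ ^ 2) := by
    unfold BB
    apply intervalIntegral.integral_mono_on (by positivity)
    · exact (hf.mul (sd_cont hf ε)).intervalIntegrable _ _
    · exact Continuous.intervalIntegrable (by fun_prop) _ _
    · intro θ _
      simp only [sd, ← sub_eq_add_neg]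
      have h3 := one_sub_sq_div_two_le_cos (x := ε)
      have h4 := mul_le_mul_of_nonneg_right h3 (sq_nonneg (f θ))
      nlinarith [sq_nonneg (f θ - f (θ + ε)), sq_nonneg (f θ - f (θ - ε))]
  refine this.trans (le_of_eq ?_)
  rw [intervalIntegral.integral_add, intervalIntegral.integral_add,
    intervalIntegral.integral_const_mul, intervalIntegral.integral_const_mul,
    intervalIntegral.integral_const_mul, e1, e2]
  · ring
  all_goals exact Continuous.intervalIntegrable (by fun_prop) _ _
end bil

end part0

section part1
open Filter Topology

def Nice (k : ℝ → ℝ) : Prop := ContDiff ℝ (⊤ : ℕ∞) k ∧ Function.Periodic k (2 * π)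

def rho (k : ℝ → ℝ) (θ : ℝ) : ℝ := k θ + deriv (deriv k) θ

lemma Nice.deriv {k : ℝ → ℝ} (hk : Nice k) : Nice (deriv k) := by
  refine ⟨?_, ?_⟩
  · have h := hk.1
    rw [show ((⊤ : ℕ∞) : WithTop ℕ∞) = ((⊤ : ℕ∞) : WithTop ℕ∞) + 1 by rfl] at h
    exact (contDiff_succ_iff_deriv.1 h).2.2
  · intro θ
    have : (fun x => k (x + 2 * π)) = k := funext hk.2
    rw [← deriv_comp_add_const, this]

lemma Nice.cont {k : ℝ → ℝ} (hk : Nice k) : Continuous k := hk.1.continuous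

lemma Nice.hd {k : ℝ → ℝ} (hk : Nice k) (θ : ℝ) : HasDerivAt k (_root_.deriv k θ) θ :=
  ((hk.1.differentiable (by simp)) θ).hasDerivAt

lemma per_bdd {f : ℝ → ℝ} (hf : Continuous f) (pf : Function.Periodic f (2 * π)) :
    ∃ C, 0 ≤ C ∧ ∀ θ, |f θ| ≤ C := by
  obtain ⟨C, hC⟩ := (isCompact_Icc (a := (0:ℝ)) (b := 2 * π)).exists_bound_of_continuousOn hf.continuousOn
  refine ⟨C, (norm_nonneg _).trans (hC 0 ⟨le_rfl, by positivity⟩), fun θ => ?_⟩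
  obtain ⟨y, hy, e⟩ := pf.exists_mem_Ico₀ (by positivity) θ
  rw [e]; exact hC y ⟨hy.1, hy.2.le⟩

lemma Nice.bdd {k : ℝ → ℝ} (hk : Nice k) : ∃ C, 0 ≤ C ∧ ∀ θ, |k θ| ≤ C := per_bdd hk.cont hk.2

lemma rho_cont {k : ℝ → ℝ} (hk : Nice k) : Continuous (rho k) := by
  have := hk.cont
  have := hk.deriv.deriv.cont
  unfold rho; fun_prop

lemma rho_per {k : ℝ → ℝ} (hk : Nice k) : Function.Periodic (rho k) (2 * π) := by
  intro θ
  simp only [rho]; rw [hk.2, hk.deriv.deriv.2]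

lemma Nice.add_mul {k a : ℝ → ℝ} (hk : Nice k) (ha : Nice a) (c : ℝ) :
    Nice (fun θ => k θ + c * a θ) := by
  refine ⟨hk.1.add (contDiff_const.mul ha.1), fun θ => ?_⟩
  show k _ + c * a _ = _
  rw [hk.2, ha.2]

lemma rho_add_mul {k a : ℝ → ℝ} (hk : Nice k) (ha : Nice a) (c θ : ℝ) :
    rho (fun θ => k θ + c * a θ) θ = rho k θ + c * rho a θ := by
  have e1 : deriv (fun θ => k θ + c * a θ) = fun θ => deriv k θ + c * deriv a θ :=
    funext fun θ => ((hk.hd θ).add ((ha.hd θ).const_mul c)).deriv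
  have e2 : deriv (fun θ => deriv k θ + c * deriv a θ) θ = _ :=
    ((hk.deriv.hd θ).add ((ha.deriv.hd θ).const_mul c)).deriv
  simp only [rho]; rw [e1, e2]; ring

lemma step_bd {F F' : ℝ → ℝ} (hF : ∀ s, HasDerivAt F (F' s) s) (h0 : F 0 = 0) {C : ℝ} (hC : 0 ≤ C) (n : ℕ)
    (hb : ∀ s, 0 ≤ s → |F' s| ≤ C * s ^ n) : ∀ s, 0 ≤ s → |F s| ≤ C * s ^ (n + 1) := by
  intro s hs
  have := norm_image_sub_le_of_norm_deriv_le_segment' (f := F) (f' := F') (a := 0) (b := s)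
    (C := C * s ^ n) (fun x _ => (hF x).hasDerivWithinAt) (fun x hx => by
      rw [Real.norm_eq_abs]
      refine (hb x hx.1).trans ?_
      have := hx.1
      gcongr
      exact hx.2.le) s ⟨hs, le_rfl⟩
  rw [h0, sub_zero, sub_zero, Real.norm_eq_abs] at this
  rw [pow_succ, ← mul_assoc]; exact this

lemma sd_taylor {k : ℝ → ℝ} (hk : Nice k) :
    ∃ C, 0 ≤ C ∧ ∀ ε, 0 ≤ ε → ∀ θ, |sd ε k θ - ε ^ 2 * rho k θ| ≤ C * ε ^ 3 := by
  obtain ⟨C0, hC0, h0⟩ := hk.bdd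
  obtain ⟨C3, hC3, h3⟩ := hk.deriv.deriv.deriv.bdd
  set k1 := deriv k with hk1
  set k2 := deriv k1 with hk2
  set k3 := deriv k2 with hk3
  refine ⟨2 * C0 + 2 * C3, by positivity, fun ε hε θ => ?_⟩
  have dp : ∀ f : ℝ → ℝ, Nice f → ∀ s, HasDerivAt (fun s => f (θ + s)) (deriv f (θ + s)) s := by
    intro f hf s; exact (hf.hd (θ + s)).comp_const_add θ s
  have dm : ∀ f : ℝ → ℝ, Nice f → ∀ s, HasDerivAt (fun s => f (θ - s)) (-deriv f (θ - s)) s := by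
    intro f hf s; exact (hf.hd (θ - s)).comp_const_sub θ s
  have A3 : ∀ s, 0 ≤ s → |k3 (θ + s) - k3 (θ - s) - 2 * sin s * k θ| ≤ (2 * C0 + 2 * C3) * s ^ 0 := by
    intro s _
    have i1 := abs_le.1 (h3 (θ + s))
    have i2 := abs_le.1 (h3 (θ - s))
    have i3 : |sin s * k θ| ≤ 1 * C0 := by
      rw [abs_mul]; gcongr; exact abs_sin_le_one s; exact h0 θ
    rw [abs_le] at i3 ⊢
    constructor <;> simp <;> linarith
  have A2 := step_bd (F := fun s => k2 (θ + s) + k2 (θ - s) + 2 * cos s * k θ - 2 * rho k θ)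
    (F' := fun s => k3 (θ + s) - k3 (θ - s) - 2 * sin s * k θ) (fun s => by
      have := (((dp k2 hk.deriv.deriv s).add (dm k2 hk.deriv.deriv s)).add
        (((hasDerivAt_cos s).const_mul 2).mul_const (k θ))).sub_const (2 * rho k θ)
      exact HasDerivAt.congr_deriv this (by ring))
    (by simp [rho]; ring) (by positivity) 0 A3
  have A1 := step_bd (F := fun s => k1 (θ + s) - k1 (θ - s) + 2 * sin s * k θ - 2 * s * rho k θ)
    (F' := fun s => k2 (θ + s) + k2 (θ - s) + 2 * cos s * k θ - 2 * rho k θ) (fun s => by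
      have := (((dp k1 hk.deriv s).sub (dm k1 hk.deriv s)).add
        (((hasDerivAt_sin s).const_mul 2).mul_const (k θ))).sub 
        (((hasDerivAt_id s).const_mul 2).mul_const (rho k θ))
      exact HasDerivAt.congr_deriv this (by simp [k2]))
    (by simp) (by positivity) _ A2
  have A0 := step_bd (F := fun s => sd s k θ - s ^ 2 * rho k θ)
    (F' := fun s => k1 (θ + s) - k1 (θ - s) + 2 * sin s * k θ - 2 * s * rho k θ) (fun s => by
      have := (((dp k hk s).add (dm k hk s)).sub
        (((hasDerivAt_cos s).const_mul 2).mul_const (k θ))).sub 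
        (((hasDerivAt_pow 2 s)).mul_const (rho k θ))
      exact HasDerivAt.congr_deriv this (by simp [k1]; try ring))
    (by simp [sd]; ring) (by positivity) _ A1
  exact A0 ε hε

lemma BB_lim {f k : ℝ → ℝ} (hf : Continuous f) (hk : Nice k) :
    Tendsto (fun ε => BB ε f k / ε ^ 2) (𝓝[>] 0) (𝓝 (∫ θ in (0:ℝ)..2 * π, f θ * rho k θ)) := by
  obtain ⟨C, hC, hs⟩ := sd_taylor hk
  obtain ⟨M, hM⟩ := (isCompact_Icc (a := (0:ℝ)) (b := 2 * π)).exists_bound_of_continuousOn hf.continuousOn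
  have hM0 : 0 ≤ M := (norm_nonneg _).trans (hM 0 ⟨le_rfl, by positivity⟩)
  rw [tendsto_iff_norm_sub_tendsto_zero]
  have lim : Tendsto (fun ε : ℝ => M * (C * ε) * |2 * π - 0|) (𝓝[>] 0) (𝓝 0) := by
    have : Continuous (fun ε : ℝ => M * (C * ε) * |2 * π - 0|) := by fun_prop
    have := this.tendsto 0
    simp only [mul_zero, zero_mul] at this
    exact this.mono_left nhdsWithin_le_nhds
  refine squeeze_zero' (Eventually.of_forall fun _ => norm_nonneg _) ?_ lim
  filter_upwards [self_mem_nhdsWithin] with ε hε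
  have hε : 0 < ε := hε
  have : BB ε f k / ε ^ 2 - ∫ θ in (0:ℝ)..2 * π, f θ * rho k θ =
      ∫ θ in (0:ℝ)..2 * π, f θ * (sd ε k θ / ε ^ 2 - rho k θ) := by
    unfold BB
    rw [← intervalIntegral.integral_div, ← intervalIntegral.integral_sub]
    · congr 1; ext θ; ring
    · exact ((hf.mul (sd_cont hk.cont ε)).div_const _).intervalIntegrable _ _
    · exact (hf.mul (rho_cont hk)).intervalIntegrable _ _
  rw [this]
  apply intervalIntegral.norm_integral_le_of_norm_le_const
  intro θ hθ
  rw [uIoc_of_le (by positivity)] at hθ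
  rw [norm_mul]
  gcongr
  · exact hM θ ⟨hθ.1.le, hθ.2⟩
  · have := hs ε hε.le θ
    rw [Real.norm_eq_abs, show sd ε k θ / ε ^ 2 - rho k θ = (sd ε k θ - ε ^ 2 * rho k θ) / ε ^ 2 by
      field_simp, abs_div, div_le_iff₀ (by positivity), abs_of_pos (show (0:ℝ) < ε ^ 2 by positivity)]
    calc _ ≤ _ := this
      _ = _ := by ring

lemma BB_loc {E : Set (ℝ × ℝ)} {φ h : ℝ → ℝ} {R M : ℝ} (hR : 0 ≤ R) (hM : 0 ≤ M) (hs : Supp E h)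
    (hb : Bd R E) (hφ : ∀ θ, 0 ≤ φ θ) (hφl : ∀ θ ψ, |φ θ - φ ψ| ≤ M * |θ - ψ|) (hφc : Continuous φ)
    (hloc : ∀ θ ε, 0 < ε → ε ≤ 1 → (∀ ψ ∈ Icc (θ - ε) (θ + ε), 0 < φ ψ) → sd ε h θ = 0) :
    Tendsto (fun ε => BB ε φ h / ε ^ 2) (𝓝[>] 0) (𝓝 0) := by
  have hc := hs.cont hb
  have e1 : ∀ ε, BB ε φ h / ε ^ 2 = ∫ θ in (0:ℝ)..2 * π, φ θ * sd ε h θ / ε ^ 2 := by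
    intro ε; unfold BB; rw [intervalIntegral.integral_div]
  simp only [e1]
  have e0 : (0:ℝ) = ∫ θ in (0:ℝ)..2 * π, (0:ℝ) := by simp
  have ev : ∀ᶠ ε : ℝ in 𝓝[>] 0, 0 < ε ∧ ε ≤ 1 := by
    have : Ioc (0:ℝ) 1 ∈ 𝓝[>] (0:ℝ) := Ioc_mem_nhdsGT (by norm_num)
    filter_upwards [this] with ε h using h
  nth_rewrite 4 [e0]
  apply intervalIntegral.tendsto_integral_filter_of_dominated_convergence (fun _ => 8 * R * M)
  · refine Eventually.of_forall fun ε => ?_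
    exact ((hφc.mul (sd_cont hc ε)).div_const _).aestronglyMeasurable
  · filter_upwards [ev] with ε hε
    refine Eventually.of_forall fun θ _ => ?_
    by_cases hp : ∀ ψ ∈ Icc (θ - ε) (θ + ε), 0 < φ ψ
    · rw [hloc θ ε hε.1 hε.2 hp]; simp; positivity
    · push Not at hp
      obtain ⟨ψ, hψ, h0⟩ := hp
      have h0 : φ ψ = 0 := le_antisymm h0 (hφ ψ)
      have h1 : φ θ ≤ M * ε := by
        have := (le_abs_self _).trans (hφl θ ψ)
        have h2 : |θ - ψ| ≤ ε := by rw [abs_le]; constructor <;> linarith [hψ.1, hψ.2]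
        have := mul_le_mul_of_nonneg_left h2 hM
        linarith
      have h2 := hs.sd_le hb hR hε.1 hε.2 θ
      have h3 := hs.sd_nonneg ε θ
      have := hφ θ
      have := hε.1
      rw [Real.norm_eq_abs, abs_of_nonneg (by positivity), div_le_iff₀ (by positivity)]
      calc _ ≤ (M * ε) * (8 * R * ε) := by gcongr
        _ = _ := by ring
  · simp
  · refine Eventually.of_forall fun θ _ => ?_
    rcases (hφ θ).eq_or_lt with h0 | h0
    · simp [← h0]
    · obtain ⟨δ, hδ, hδ'⟩ := Metric.continuous_iff.1 hφc θ (φ θ) h0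
      refine tendsto_const_nhds.congr' ?_
      have : Ioo (0:ℝ) δ ∈ 𝓝[>] (0:ℝ) := Ioo_mem_nhdsGT hδ
      filter_upwards [ev, this] with ε hε hε'
      rw [hloc θ ε hε.1 hε.2, mul_zero, zero_div]
      intro ψ hψ
      have := hδ' ψ (by rw [Real.dist_eq, abs_lt]; constructor <;> linarith [hψ.1, hψ.2, hε'.2])
      rw [Real.dist_eq, abs_lt] at this
      linarith [this.1]

end part1

section part2
open Filter Topology

lemma wu_loc {k h : ℝ → ℝ} {R : ℝ} (hk : Nice k) (hs : Supp (Wu k) h) (hb : Bd R (Wu k))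
    (θ ε : ℝ) (hε : 0 < ε) (hε1 : ε ≤ 1) (hp : ∀ ψ ∈ Icc (θ - ε) (θ + ε), 0 < k ψ - h ψ) :
    sd ε h θ = 0 := by
  by_contra hne
  have hpos : 0 < sd ε h θ := lt_of_le_of_ne (hs.sd_nonneg ε θ) (Ne.symm hne)
  have hpi := pi_gt_three
  set α := θ - ε with hα
  set β := θ + ε with hβ
  have hSe : sin (β - α) = 2 * sin ε * cos ε := by
    rw [show β - α = 2 * ε by simp [hα, hβ]; ring, sin_two_mul]
  have hsε : 0 < sin ε := sin_pos_of_pos_of_lt_pi hε (by linarith)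
  have hcε : 0 < cos ε := cos_pos_of_mem_Ioo ⟨by linarith, by linarith⟩
  set S := sin (β - α) with hS
  have hS0 : 0 < S := by rw [hSe]; positivity
  have idt : ∀ (x : ℝ × ℝ) (ψ : ℝ), S * dt x ψ = dt x α * sin (β - ψ) + dt x β * sin (ψ - α) := by
    intro x ψ
    rw [hS]; simp only [dt, sin_sub]; ring
  set z : ℝ × ℝ := ((h α * sin β - h β * sin α) / S, (h β * cos α - h α * cos β) / S) with hz
  have zdt : ∀ ψ, S * dt z ψ = h α * sin (β - ψ) + h β * sin (ψ - α) := by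
    intro ψ
    simp only [dt, hz, sin_sub]; field_simp; ring
  obtain ⟨x, hx, hxe⟩ := (hs θ).1
  have hzθ : h θ < dt z θ := by
    have := zdt θ
    rw [show β - θ = ε by simp [hβ], show θ - α = ε by simp [hα], hSe] at this
    have h2 : 2 * cos ε * dt z θ = h α + h β := by
      apply mul_left_cancel₀ hsε.ne'
      linarith
    unfold sd at hpos
    have : 2 * cos ε * h θ < 2 * cos ε * dt z θ := by rw [h2]; linarith
    exact lt_of_mul_lt_mul_left this (by positivity)
  have hcont : Continuous (fun ψ => k ψ - h ψ) := hk.cont.sub (hs.cont hb)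
  obtain ⟨ψ0, hψ0, hmin⟩ := (isCompact_Icc (a := α) (b := β)).exists_isMinOn
    ⟨α, le_rfl, by simp [hα, hβ]; linarith⟩ hcont.continuousOn
  set δ := k ψ0 - h ψ0 with hδ
  have hδ0 : 0 < δ := hp ψ0 hψ0
  obtain ⟨C, hC, hCb⟩ := per_bdd (dt_cont (z - x)) (dt_per (z - x))
  obtain ⟨t, ht0, ht1, htC⟩ : ∃ t : ℝ, 0 < t ∧ t ≤ 1 ∧ t * C ≤ δ := by
    refine ⟨min 1 (δ / (C + 1)), by positivity, min_le_left _ _, ?_⟩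
    calc min 1 (δ / (C + 1)) * C ≤ δ / (C + 1) * (C + 1) := by
          gcongr
          · exact min_le_right _ _
          · linarith
      _ = δ := by field_simp
  set y := x + t • (z - x) with hy
  have hyd : ∀ ψ, dt y ψ = dt x ψ + t * (dt (z - x) ψ) := by
    intro ψ; rw [hy, dt_add, dt_smul]
  have hyE : y ∈ Wu k := by
    intro ψ
    have pF : Function.Periodic (fun ψ => k ψ - dt y ψ) (2 * π) := by
      intro u; show k _ - dt y _ = _
      rw [hk.2, dt_per]
    obtain ⟨ψ', hψ', e⟩ := pF.exists_mem_Ico (by positivity) ψ (θ - π)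
    suffices dt y ψ' ≤ k ψ' by
      have e : k ψ - dt y ψ = k ψ' - dt y ψ' := e
      linarith
    clear e
    have hb1 := hψ'.1
    have hb2 := hψ'.2
    by_cases hin : ψ' ∈ Icc α β
    · have h1 : δ ≤ k ψ' - h ψ' := hmin hin
      have h2 := (hs ψ').2 x hx
      have h3 := mul_le_mul_of_nonneg_left ((le_abs_self _).trans (hCb ψ')) ht0.le
      rw [hyd]; linarith
    · have hzh : dt z ψ' ≤ h ψ' := by
        apply le_of_mul_le_mul_left _ hS0
        rw [zdt]
        rcases le_or_gt (sin (β - ψ')) 0 with s1 | s1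
        · rcases le_or_gt (sin (ψ' - α)) 0 with s2 | s2
          · have h1 := mul_le_mul_of_nonneg_left ((hs ψ').2 x hx) hS0.le
            rw [idt] at h1
            have h2 := mul_le_mul_of_nonpos_right ((hs α).2 x hx) s1
            have h3 := mul_le_mul_of_nonpos_right ((hs β).2 x hx) s2
            linarith
          · obtain ⟨w, hw, hwe⟩ := (hs β).1
            have h1 := mul_le_mul_of_nonneg_left ((hs ψ').2 w hw) hS0.le
            rw [idt, hwe] at h1
            have h2 := mul_le_mul_of_nonpos_right ((hs α).2 w hw) s1
            linarith
        · rcases le_or_gt (sin (ψ' - α)) 0 with s2 | s2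
          · obtain ⟨w, hw, hwe⟩ := (hs α).1
            have h1 := mul_le_mul_of_nonneg_left ((hs ψ').2 w hw) hS0.le
            rw [idt, hwe] at h1
            have h2 := mul_le_mul_of_nonpos_right ((hs β).2 w hw) s2
            linarith
          · exfalso
            apply hin
            constructor
            · by_contra hlt
              push Not at hlt
              have := sin_nonpos_of_nonpos_of_neg_pi_le (x := ψ' - α) (by linarith) (by linarith)
              linarith
            · by_contra hlt
              push Not at hlt
              have := sin_nonpos_of_nonpos_of_neg_pi_le (x := β - ψ') (by linarith) (by linarith)
              linarith
      have h1 := hx ψ'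
      have h2 := (hs ψ').2 x hx
      rw [hyd, dt_sub]
      have h3 := mul_le_mul_of_nonneg_left hzh ht0.le
      obtain ⟨w, hw, hwe⟩ := (hs ψ').1
      have h4 : h ψ' ≤ k ψ' := hwe ▸ hw ψ'
      nlinarith
  have := (hs θ).2 y hyE
  rw [hyd, dt_sub, hxe] at this
  nlinarith

lemma Supp.le_wu {k h : ℝ → ℝ} (hs : Supp (Wu k) h) (θ : ℝ) : h θ ≤ k θ := by
  obtain ⟨w, hw, hwe⟩ := (hs θ).1
  rw [← hwe]; exact hw θ

lemma nice_lip {k : ℝ → ℝ} (hk : Nice k) : ∃ M, 0 ≤ M ∧ ∀ θ ψ, |k θ - k ψ| ≤ M * |θ - ψ| := by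
  obtain ⟨M, hM, hb⟩ := hk.deriv.bdd
  refine ⟨M, hM, fun θ ψ => ?_⟩
  have := Convex.norm_image_sub_le_of_norm_deriv_le (f := k) (C := M) (s := univ) (x := ψ) (y := θ)
    (fun x _ => (hk.hd x).differentiableAt) (fun z _ => hb z) convex_univ trivial trivial
  simpa using this

lemma self_lim {k h : ℝ → ℝ} {R : ℝ} (hR : 0 ≤ R) (hk : Nice k) (hs : Supp (Wu k) h) (hb : Bd R (Wu k)) :
    Tendsto (fun ε => BB ε h h / ε ^ 2) (𝓝[>] 0) (𝓝 (∫ θ in (0:ℝ)..2 * π, h θ * rho k θ)) := by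
  have hc := hs.cont hb
  obtain ⟨M, hM, hl⟩ := nice_lip hk
  have h1 := BB_lim hc hk
  have h2 := BB_loc (φ := fun θ => k θ - h θ) (M := M + 2 * R) hR (by positivity) hs hb
    (fun θ => sub_nonneg.2 (hs.le_wu θ)) (fun θ ψ => by
      have a1 := hl θ ψ
      have a2 := hs.lip hb θ ψ
      rw [show k θ - h θ - (k ψ - h ψ) = (k θ - k ψ) - (h θ - h ψ) by ring]
      refine (abs_sub _ _).trans ?_
      linarith) (hk.cont.sub hc) (wu_loc hk hs hb)
  have := h1.sub h2
  rw [sub_zero] at this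
  refine this.congr fun ε => ?_
  have pp : Function.Periodic (fun θ => k θ - h θ) (2 * π) := by
    intro u; show k _ - h _ = _
    rw [hk.2, hs.per]
  rw [BB_symm (f := fun θ => k θ - h θ) (hk.cont.sub hc) hc pp hs.per]
  have := BB_add_right (f := h) (g := fun θ => k θ - h θ) (h := h) hc (hk.cont.sub hc) hc 1 ε
  simp only [one_mul, sub_add_cancel] at this
  change BB ε h k = _ at this
  rw [this]; ring

lemma main_ineq {k k' a h h' : ℝ → ℝ} {R s : ℝ} (hR : 0 ≤ R) (hk : Nice k) (hk' : Nice k') (ha : Nice a)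
    (hkk : ∀ θ, k' θ = k θ - s * a θ)
    (hs : Supp (Wu k) h) (hb : Bd R (Wu k)) (hs' : Supp (Wu k') h') (hb' : Bd R (Wu k')) :
    (1/2) * (∫ θ in (0:ℝ)..2 * π, h' θ * rho k' θ) ≤ (1/2) * (∫ θ in (0:ℝ)..2 * π, h θ * rho k θ)
      - s * (∫ θ in (0:ℝ)..2 * π, h θ * rho a θ) + (1/2) * ∫ θ in (0:ℝ)..2 * π, (h θ - h' θ) ^ 2 := by
  have hc := hs.cont hb
  have hc' := hs'.cont hb'
  have l1 := self_lim hR hk hs hb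
  have l2 := self_lim hR hk' hs' hb'
  have l3 := BB_lim hc hk
  have l4 := BB_lim hc ha
  set I1 := ∫ θ in (0:ℝ)..2 * π, h θ * rho k θ
  set I2 := ∫ θ in (0:ℝ)..2 * π, h' θ * rho k' θ
  set I3 := ∫ θ in (0:ℝ)..2 * π, h θ * rho a θ
  set Q := ∫ θ in (0:ℝ)..2 * π, (h θ - h' θ) ^ 2
  have key : I1 + I2 - Q ≤ 2 * (I1 - s * I3) := by
    refine le_of_tendsto_of_tendsto ((l1.add l2).sub_const Q) ((l3.sub (l4.const_mul s)).const_mul 2) ?_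
    filter_upwards [self_mem_nhdsWithin] with ε hε
    have hε : 0 < ε := hε
    have m1 : BB ε h h' ≤ BB ε h k - s * BB ε h a := by
      have e1 := BB_add_right (f := h) (g := k) (h := a) hc hk.cont ha.cont (-s) ε
      have e2 : (fun θ => k θ + -s * a θ) = k' := by ext θ; rw [hkk]; ring
      rw [e2] at e1
      have e3 := BB_add_right (f := h) (g := k') (h := h') hc hk'.cont hc' (-1) ε
      have pp : Function.Periodic (fun θ => k' θ + -1 * h' θ) (2 * π) := by
        intro u; show k' _ + -1 * h' _ = _
        rw [hk'.2, hs'.per]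
      rw [BB_symm (h := fun θ => k' θ + -1 * h' θ) hc (hk'.cont.add (continuous_const.mul hc')) hs.per pp] at e3
      have e4 := BB_nonneg (f := fun θ => k' θ + -1 * h' θ) hs
        (fun θ => by have := hs'.le_wu θ; linarith) ε
      linarith
    have m2 : BB ε h h + BB ε h' h' - 2 * BB ε h h' ≤ ε ^ 2 * Q := by
      have pp : Function.Periodic (fun θ => h θ + -1 * h' θ) (2 * π) := by
        intro u; show h _ + -1 * h' _ = _
        rw [hs.per, hs'.per]
      have cc : Continuous (fun θ => h θ + -1 * h' θ) := by fun_prop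
      have b := BB_self_le cc pp ε
      rw [BB_add_right cc hc hc', BB_symm cc hc pp hs.per, BB_symm cc hc' pp hs'.per,
        BB_add_right hc hc hc', BB_add_right hc' hc hc', BB_symm hc' hc hs'.per hs.per] at b
      have : (fun θ => (h θ + -1 * h' θ) ^ 2) = fun θ => (h θ - h' θ) ^ 2 := by ext; ring
      rw [this] at b
      linarith
    have e : BB ε h h / ε ^ 2 + BB ε h' h' / ε ^ 2 - Q = (BB ε h h + BB ε h' h' - ε ^ 2 * Q) / ε ^ 2 := by
      field_simp
    have e' : 2 * (BB ε h k / ε ^ 2 - s * (BB ε h a / ε ^ 2)) = (2 * (BB ε h k - s * BB ε h a)) / ε ^ 2 := by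
      field_simp
    show BB ε h h / ε ^ 2 + BB ε h' h' / ε ^ 2 - Q ≤ 2 * (BB ε h k / ε ^ 2 - s * (BB ε h a / ε ^ 2))
    rw [e, e']
    gcongr
    linarith
  linarith

lemma degen {k h : ℝ → ℝ} {R n1 n2 c : ℝ} (hR : 0 ≤ R) (hk : Nice k) (hs : Supp (Wu k) h) (hb : Bd R (Wu k))
    (hcomp : IsCompact (Wu k)) (hn : n1 ^ 2 + n2 ^ 2 ≠ 0)
    (hflat : ∀ x ∈ Wu k, n1 * x.1 + n2 * x.2 = c) :
    ∫ θ in (0:ℝ)..2 * π, h θ * rho k θ = 0 := by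
  have hc := hs.cont hb
  have hne : (Wu k).Nonempty := ⟨_, (hs 0).1.choose_spec.1⟩
  have hdc : Continuous (fun x : ℝ × ℝ => -n2 * x.1 + n1 * x.2) := by fun_prop
  obtain ⟨y, hy, hymin⟩ := hcomp.exists_isMinOn hne hdc.continuousOn
  obtain ⟨z, hz, hzmax⟩ := hcomp.exists_isMaxOn hne hdc.continuousOn
  have hN : 0 < n1 ^ 2 + n2 ^ 2 := lt_of_le_of_ne (by positivity) (Ne.symm hn)
  have idt : ∀ x ∈ Wu k, ∀ ψ, (n1 ^ 2 + n2 ^ 2) * dt x ψ = c * (n1 * cos ψ + n2 * sin ψ) +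
      (-n2 * x.1 + n1 * x.2) * (-n2 * cos ψ + n1 * sin ψ) := by
    intro x hx ψ
    rw [← hflat x hx]; simp only [dt]; ring
  have hmax : ∀ ψ, h ψ = dt y ψ ∨ h ψ = dt z ψ := by
    intro ψ
    obtain ⟨x, hx, e⟩ := (hs ψ).1
    have hy1 : -n2 * y.1 + n1 * y.2 ≤ -n2 * x.1 + n1 * x.2 := hymin hx
    have hz1 : -n2 * x.1 + n1 * x.2 ≤ -n2 * z.1 + n1 * z.2 := hzmax hx
    rcases le_total 0 (-n2 * cos ψ + n1 * sin ψ) with s | s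
    · right
      apply le_antisymm _ ((hs ψ).2 z hz)
      rw [← e]
      apply le_of_mul_le_mul_left _ hN
      rw [idt x hx, idt z hz]
      have := mul_le_mul_of_nonneg_right hz1 s
      linarith
    · left
      apply le_antisymm _ ((hs ψ).2 y hy)
      rw [← e]
      apply le_of_mul_le_mul_left _ hN
      rw [idt x hx, idt y hy]
      have := mul_le_mul_of_nonpos_right hy1 s
      linarith
  have l1 := self_lim hR hk hs hb
  have hcφ : Continuous (fun θ => h θ - dt y θ) := hc.sub (dt_cont y)
  have pp : Function.Periodic (fun θ => h θ - dt y θ) (2 * π) := by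
    intro u; show h _ - dt y _ = _
    rw [hs.per, dt_per]
  have l2 := BB_loc (φ := fun θ => h θ - dt y θ) (M := 4 * R) hR (by positivity) hs hb
    (fun θ => sub_nonneg.2 ((hs θ).2 y hy)) (fun θ ψ => by
      have a1 := dt_lip (hb y hy) θ ψ
      have a2 := hs.lip hb θ ψ
      rw [show h θ - dt y θ - (h ψ - dt y ψ) = (h θ - h ψ) - (dt y θ - dt y ψ) by ring]
      refine (abs_sub _ _).trans ?_
      linarith) hcφ (fun θ ε hε _ hp => by
      have hz : ∀ ψ ∈ Icc (θ - ε) (θ + ε), h ψ = dt z ψ := by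
        intro ψ hψ
        have := hp ψ hψ
        rcases hmax ψ with e | e
        · linarith
        · exact e
      have := dt_sd z ε θ
      unfold sd at this ⊢
      rw [hz θ ⟨by linarith, by linarith⟩, hz (θ + ε) ⟨by linarith, by linarith⟩,
        hz (θ - ε) ⟨by linarith, by linarith⟩, this])
  refine tendsto_nhds_unique l1 (l2.congr fun ε => ?_)
  rw [BB_symm hcφ hc pp hs.per]
  have := BB_add_right (f := h) (g := fun θ => h θ - dt y θ) (h := dt y) hc hcφ (dt_cont y) 1 ε
  simp only [one_mul, sub_add_cancel] at this
  change BB ε h h = _ at this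
  rw [this]
  have : BB ε h (dt y) = 0 := by simp [BB, dt_sd]
  rw [this]; simp

end part2

section part3
open Filter Topology

lemma wu_closed (k : ℝ → ℝ) : IsClosed (Wu k) := by
  have : Wu k = ⋂ θ, {x | dt x θ ≤ k θ} := by ext x; simp [Wu]
  rw [this]
  exact isClosed_iInter fun θ => isClosed_le (dt_cont' θ) continuous_const

lemma wu_convex (k : ℝ → ℝ) : Convex ℝ (Wu k) := by
  intro x hx y hy a b ha hb hab θ
  rw [dt_add, dt_smul, dt_smul]
  have h1 := mul_le_mul_of_nonneg_left (hx θ) ha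
  have h2 := mul_le_mul_of_nonneg_left (hy θ) hb
  have : k θ = a * k θ + b * k θ := by rw [← add_mul, hab, one_mul]
  linarith

lemma wu_bd {k : ℝ → ℝ} (hk : Nice k) : ∃ R, 0 ≤ R ∧ Bd R (Wu k) := by
  obtain ⟨C, hC, hb⟩ := hk.bdd
  refine ⟨C, hC, fun x hx => ?_⟩
  have b := fun θ => (hx θ).trans ((le_abs_self _).trans (hb θ))
  have h1 := b 0
  have h2 := b π
  have h3 := b (π / 2)
  have h4 := b (-(π / 2))
  simp [dt] at h1 h2 h3 h4
  exact ⟨abs_le.2 ⟨by linarith, h1⟩, abs_le.2 ⟨by linarith, h3⟩⟩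

lemma bd_compact {E : Set (ℝ × ℝ)} {R : ℝ} (hc : IsClosed E) (hb : Bd R E) : IsCompact E := by
  refine (isCompact_Icc (a := ((-R, -R) : ℝ × ℝ)) (b := (R, R))).of_isClosed_subset hc ?_
  intro x hx
  obtain ⟨h1, h2⟩ := hb x hx
  rw [abs_le] at h1 h2
  exact ⟨⟨h1.1, h2.1⟩, ⟨h1.2, h2.2⟩⟩

lemma exists_supp {E : Set (ℝ × ℝ)} (hc : IsCompact E) (hne : E.Nonempty) : ∃ h, Supp E h := by
  have : ∀ θ, ∃ x ∈ E, ∀ y ∈ E, dt y θ ≤ dt x θ := by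
    intro θ
    obtain ⟨x, hx, hm⟩ := hc.exists_isMaxOn hne (dt_cont' θ).continuousOn
    exact ⟨x, hx, fun y hy => hm hy⟩
  choose f hf hm using this
  exact ⟨fun θ => dt (f θ) θ, fun θ => ⟨⟨f θ, hf θ, rfl⟩, hm θ⟩⟩

lemma Supp.uniq {E : Set (ℝ × ℝ)} {h h' : ℝ → ℝ} (hs : Supp E h) (hs' : Supp E h') : h = h' := by
  ext θ
  obtain ⟨x, hx, e⟩ := (hs θ).1
  obtain ⟨y, hy, e'⟩ := (hs' θ).1
  have := (hs' θ).2 x hx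
  have := (hs θ).2 y hy
  linarith

lemma Supp.mono {E F : Set (ℝ × ℝ)} {h h' : ℝ → ℝ} (hs : Supp E h) (hs' : Supp F h') (hEF : E ⊆ F) (θ : ℝ) :
    h θ ≤ h' θ := by
  obtain ⟨x, hx, e⟩ := (hs θ).1
  rw [← e]; exact (hs' θ).2 x (hEF hx)

def kr (g a : ℝ → ℝ) (r : ℝ) : ℝ → ℝ := fun θ => g θ + (-r) * a θ

lemma per_lower {a : ℝ → ℝ} (ha : Nice a) (hp : ∀ θ, 0 < a θ) : ∃ c, 0 < c ∧ ∀ θ, c ≤ a θ := by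
  obtain ⟨x, hx, hm⟩ := (isCompact_Icc (a := (0:ℝ)) (b := 2 * π)).exists_isMinOn
    ⟨0, le_rfl, by positivity⟩ ha.cont.continuousOn
  refine ⟨a x, hp x, fun θ => ?_⟩
  obtain ⟨y, hy, e⟩ := ha.2.exists_mem_Ico₀ (by positivity) θ
  rw [e]; exact hm ⟨hy.1, hy.2.le⟩

/-- A point with some room to spare is interior. -/
lemma wu_interior {k a : ℝ → ℝ} (ha : Nice a) (hp : ∀ θ, 0 < a θ) {x : ℝ × ℝ} {s : ℝ} (hs : 0 < s)
    (hx : ∀ θ, dt x θ + s * a θ ≤ k θ) : x ∈ interior (Wu k) := by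
  obtain ⟨c, hc, hca⟩ := per_lower ha hp
  rw [mem_interior_iff_mem_nhds, Metric.mem_nhds_iff]
  refine ⟨s * c / 2, by positivity, fun y hy θ => ?_⟩
  rw [mem_ball_iff_norm] at hy
  have h1 : |(y - x).1| ≤ s * c / 2 := (norm_fst_le (y - x)).trans hy.le
  have h2 : |(y - x).2| ≤ s * c / 2 := (norm_snd_le (y - x)).trans hy.le
  have := (le_abs_self _).trans (dt_bd ⟨h1, h2⟩ θ)
  rw [dt_sub] at this
  have := hx θ
  have := mul_le_mul_of_nonneg_left (hca θ) hs.le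
  linarith

lemma wu_interior_conv {k a : ℝ → ℝ} (ha : Nice a)
    (hne : (interior (Wu k)).Nonempty) : ∃ (x : ℝ × ℝ) (s : ℝ), 0 < s ∧ ∀ θ, dt x θ + s * a θ ≤ k θ := by
  obtain ⟨x, hx⟩ := hne
  obtain ⟨C, hC, hCa⟩ := ha.bdd
  rw [mem_interior_iff_mem_nhds, Metric.mem_nhds_iff] at hx
  obtain ⟨δ, hδ, hsub⟩ := hx
  refine ⟨x, δ / 2 / (C + 1), by positivity, fun θ => ?_⟩
  have hy : x + (δ / 2) • er θ ∈ Wu k := by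
    apply hsub
    rw [mem_ball_iff_norm, add_sub_cancel_left, norm_smul]
    have : ‖er θ‖ ≤ 1 := by
      rw [er, Prod.norm_def]
      exact max_le (abs_cos_le_one θ) (abs_sin_le_one θ)
    rw [Real.norm_eq_abs, abs_of_pos (by positivity)]
    nlinarith [norm_nonneg (er θ)]
  have := hy θ
  rw [dt_add, dt_smul] at this
  have e : dt (er θ) θ = 1 := by simp only [dt, er]; nlinarith [sin_sq_add_cos_sq θ]
  rw [e, mul_one] at this
  have h2 : δ / 2 / (C + 1) * a θ ≤ δ / 2 := by
    have := (le_abs_self _).trans (hCa θ)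
    rw [div_mul_eq_mul_div, div_le_iff₀ (by positivity)]
    gcongr; linarith
  linarith

lemma flat_of_empty {E : Set (ℝ × ℝ)} (hc : Convex ℝ E) (hne : E.Nonempty) (hi : ¬ (interior E).Nonempty) :
    ∃ n1 n2 c : ℝ, n1 ^ 2 + n2 ^ 2 ≠ 0 ∧ ∀ x ∈ E, n1 * x.1 + n2 * x.2 = c := by
  rw [hc.interior_nonempty_iff_affineSpan_eq_top] at hi
  obtain ⟨x0, hx0⟩ := hne
  have hd : (affineSpan ℝ E).direction < ⊤ := by
    rw [lt_top_iff_ne_top]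
    intro h
    exact hi ((AffineSubspace.direction_eq_top_iff_of_nonempty ⟨x0, subset_affineSpan ℝ E hx0⟩).1 h)
  obtain ⟨f, hf, hle⟩ := Submodule.exists_le_ker_of_lt_top _ hd
  have fe : ∀ x : ℝ × ℝ, f x = f (1, 0) * x.1 + f (0, 1) * x.2 := by
    intro x
    have : x = x.1 • ((1, 0) : ℝ × ℝ) + x.2 • ((0, 1) : ℝ × ℝ) := by ext <;> simp
    conv_lhs => rw [this]
    rw [map_add, map_smul, map_smul]; simp [mul_comm]
  refine ⟨f (1, 0), f (0, 1), f x0, ?_, fun x hx => ?_⟩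
  · intro h0
    apply hf
    have h1 : f (1, 0) = 0 := by nlinarith [sq_nonneg (f (1, 0)), sq_nonneg (f (0, 1))]
    have h2 : f (0, 1) = 0 := by nlinarith [sq_nonneg (f (1, 0)), sq_nonneg (f (0, 1))]
    ext <;> simp [h1, h2]
  · rw [← fe]
    have : x -ᵥ x0 ∈ (affineSpan ℝ E).direction :=
      AffineSubspace.vsub_mem_direction (subset_affineSpan ℝ E hx) (subset_affineSpan ℝ E hx0)
    have := hle this
    rw [LinearMap.mem_ker, vsub_eq_sub, map_sub] at this
    linarith

end part3

section part4
open Filter Topology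

lemma kr_nice {g a : ℝ → ℝ} (hg : Nice g) (ha : Nice a) (r : ℝ) : Nice (kr g a r) := hg.add_mul ha (-r)

lemma kr_sub {g a : ℝ → ℝ} (hp : ∀ θ, 0 < a θ) {r r' : ℝ} (h : r ≤ r') : Wu (kr g a r') ⊆ Wu (kr g a r) := by
  intro x hx θ
  refine (hx θ).trans ?_
  simp only [kr]
  nlinarith [hp θ]

lemma kr_zero (g a : ℝ → ℝ) : kr g a 0 = g := by ext; simp [kr]

lemma nested {g a : ℝ → ℝ} {R c r0 θ : ℝ} (hb : Bd R (Wu g)) (hp : ∀ θ, 0 < a θ) (hr0 : 0 < r0)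
    (h : ∀ r, 0 ≤ r → r < r0 → ∃ x ∈ Wu (kr g a r), c ≤ dt x θ) : ∃ x ∈ Wu (kr g a r0), c ≤ dt x θ := by
  have hr : ∀ n : ℕ, 0 ≤ r0 - r0 * (1 / ((n:ℝ) + 1)) ∧ r0 - r0 * (1 / ((n:ℝ) + 1)) < r0 := by
    intro n
    have h1 : 1 / ((n:ℝ) + 1) ≤ 1 := by
      rw [div_le_one (by positivity)]; linarith [Nat.cast_nonneg (α := ℝ) n]
    have h2 : 0 < 1 / ((n:ℝ) + 1) := by positivity
    constructor <;> nlinarith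
  choose x hx hxc using fun n : ℕ => h _ (hr n).1 (hr n).2
  have hcomp := bd_compact (wu_closed g) hb
  have hxg : ∀ n, x n ∈ Wu g := by
    intro n
    have := kr_sub (g := g) hp (hr n).1 (hx n)
    rwa [kr_zero] at this
  obtain ⟨y, hy, φ, hφ, hlim⟩ := hcomp.tendsto_subseq hxg
  have hrl : Tendsto (fun n : ℕ => r0 - r0 * (1 / ((φ n:ℝ) + 1))) atTop (𝓝 r0) := by
    have := ((tendsto_one_div_add_atTop_nhds_zero_nat (𝕜 := ℝ)).const_mul r0).const_sub r0
    simp only [mul_zero, sub_zero] at this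
    exact this.comp hφ.tendsto_atTop
  refine ⟨y, fun ψ => ?_, ?_⟩
  · refine le_of_tendsto_of_tendsto (((dt_cont' ψ).tendsto y).comp hlim)
      ((hrl.neg.mul_const (a ψ)).const_add (g ψ)) (Eventually.of_forall fun n => ?_)
    exact hx (φ n) ψ
  · exact ge_of_tendsto' (((dt_cont' θ).tendsto y).comp hlim) fun n => hxc (φ n)

def Rset (g a : ℝ → ℝ) : Set ℝ := {r | 0 ≤ r ∧ (Wu (kr g a r)).Nonempty}


lemma rset_zero {g a : ℝ → ℝ} (hgs : Supp (Wu g) g) : (0:ℝ) ∈ Rset g a := by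
  refine ⟨le_rfl, ?_⟩
  rw [kr_zero]
  exact ⟨_, (hgs 0).1.choose_spec.1⟩

lemma rset_bdd {g a : ℝ → ℝ} (hp : ∀ θ, 0 < a θ) : BddAbove (Rset g a) := by
  refine ⟨(g 0 + g (0 + π)) / (a 0 + a (0 + π)), fun r hr => ?_⟩
  obtain ⟨_, x, hx⟩ := hr
  have h1 := hx 0
  have h2 := hx (0 + π)
  rw [dt_pi] at h2
  have := hp 0
  have := hp (0 + π)
  rw [le_div_iff₀ (by positivity)]
  simp only [kr] at h1 h2
  linarith

lemma rset_mem {g a : ℝ → ℝ} (hg : Nice g) (hp : ∀ θ, 0 < a θ) (hgs : Supp (Wu g) g) : sSup (Rset g a) ∈ Rset g a := by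
  have h0 := rset_zero (a := a) hgs
  have hbd := rset_bdd (g := g) hp
  rcases (le_csSup hbd h0).eq_or_lt with e | hlt
  · rw [← e]; exact h0
  · refine ⟨hlt.le, ?_⟩
    obtain ⟨R, hR, hb⟩ := wu_bd hg
    obtain ⟨x, hx, _⟩ := nested (c := -(2 * R)) (θ := 0) hb hp hlt (fun r hr hr' => by
      obtain ⟨r1, hr1, hlt1⟩ := exists_lt_of_lt_csSup ⟨0, h0⟩ hr'
      obtain ⟨x, hx⟩ := hr1.2
      have hx' := kr_sub hp hlt1.le hx
      have hx0 := kr_sub hp hr hx'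
      rw [kr_zero] at hx0
      exact ⟨x, hx', (abs_le.1 (dt_bd (hb x hx0) 0)).1⟩)
    exact ⟨x, hx⟩

lemma core {g a : ℝ → ℝ} (hg : Nice g) (ha : Nice a) (hp : ∀ θ, 0 < a θ) (hgs : Supp (Wu g) g) : ∃ L : ℝ → ℝ, (∀ r ∈ Icc 0 (sSup (Rset g a)), ∀ h, Supp (Wu (kr g a r)) h →
      L r = ∫ θ in (0:ℝ)..2 * π, h θ * rho a θ) ∧
    (1/2) * (∫ θ in (0:ℝ)..2 * π, g θ * rho g θ) = ∫ r in (0:ℝ)..sSup (Rset g a), L r := by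
  have hmem := rset_mem hg hp hgs
  have hbd := rset_bdd (g := g) hp
  set ρ := sSup (Rset g a) with hρ
  have hρ0 : 0 ≤ ρ := hmem.1
  obtain ⟨R, hR, hb⟩ := wu_bd hg
  have hsub0 : ∀ r, 0 ≤ r → Wu (kr g a r) ⊆ Wu g := by
    intro r hr
    have := kr_sub (g := g) hp hr
    rwa [kr_zero] at this
  have hbr : ∀ r, 0 ≤ r → Bd R (Wu (kr g a r)) := fun r hr x hx => hb x (hsub0 r hr hx)
  have hcomp : ∀ r, 0 ≤ r → IsCompact (Wu (kr g a r)) := fun r hr => bd_compact (wu_closed _) (hbr r hr)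
  have hne : ∀ r, r ≤ ρ → (Wu (kr g a r)).Nonempty := fun r hr => hmem.2.mono (kr_sub hp hr)
  have hex : ∀ r, ∃ h, r ∈ Icc 0 ρ → Supp (Wu (kr g a r)) h := by
    intro r
    by_cases hr : r ∈ Icc 0 ρ
    · obtain ⟨h, hh⟩ := exists_supp (hcomp r hr.1) (hne r hr.2)
      exact ⟨h, fun _ => hh⟩
    · exact ⟨0, fun h => absurd h hr⟩
  choose h hs using hex
  have hcont : ∀ r ∈ Icc 0 ρ, Continuous (h r) := fun r hr => (hs r hr).cont (hbr r hr.1)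
  have hmono : ∀ r r', 0 ≤ r → r ≤ r' → r' ≤ ρ → ∀ θ, h r' θ ≤ h r θ := by
    intro r r' h0 h1 h2 θ
    exact (hs r' ⟨h0.trans h1, h2⟩).mono (hs r ⟨h0, h1.trans h2⟩) (kr_sub hp h1) θ
  obtain ⟨x0, hx0⟩ := hmem.2
  have hlip1 : ∀ r r', 0 ≤ r → r ≤ r' → r' < ρ → ∀ θ, h r θ - h r' θ ≤ (r' - r) * (4 * R / (ρ - r)) := by
    intro r r' h0 h1 h2 θ
    obtain ⟨x, hx, e⟩ := (hs r ⟨h0, (h1.trans_lt h2).le⟩ θ).1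
    have hd : 0 < ρ - r := by linarith
    set t := (r' - r) / (ρ - r) with ht
    have ht0 : 0 ≤ t := by rw [ht]; apply div_nonneg <;> linarith
    have ht1 : t ≤ 1 := by rw [ht, div_le_one hd]; linarith
    have hte : t * (ρ - r) = r' - r := by rw [ht]; field_simp
    have hy : (1 - t) • x + t • x0 ∈ Wu (kr g a r') := by
      intro ψ
      rw [dt_add, dt_smul, dt_smul]
      have i1 := mul_le_mul_of_nonneg_left (hx ψ) (sub_nonneg.2 ht1)
      have i2 := mul_le_mul_of_nonneg_left (hx0 ψ) ht0
      simp only [kr] at i1 i2 ⊢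
      have : r' = r + t * (ρ - r) := by linarith
      rw [this]
      linarith
    have h3 := (hs r' ⟨h0.trans h1, h2.le⟩ θ).2 _ hy
    rw [dt_add, dt_smul, dt_smul, e] at h3
    have h4 := abs_le.1 (dt_bd (hbr r h0 x hx) θ)
    have h5 := abs_le.1 (dt_bd (hbr ρ hρ0 x0 hx0) θ)
    rw [e] at h4
    have h6 := mul_le_mul_of_nonneg_left (show h r θ - dt x0 θ ≤ 4 * R by linarith) ht0
    have : (r' - r) * (4 * R / (ρ - r)) = t * (4 * R) := by rw [ht]; ring
    rw [this]; linarith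
  have hlip : ∀ q r r', q < ρ → 0 ≤ r → r ≤ q → 0 ≤ r' → r' ≤ q → ∀ θ,
      |h r θ - h r' θ| ≤ 4 * R / (ρ - q) * |r' - r| := by
    have key : ∀ q r r', q < ρ → 0 ≤ r → r ≤ r' → r' ≤ q → ∀ θ,
      |h r θ - h r' θ| ≤ 4 * R / (ρ - q) * |r' - r| := by
      intro q r r' hq h0 h1 h2 θ
      rw [abs_of_nonneg (sub_nonneg.2 (hmono r r' h0 h1 (by linarith) θ)), abs_of_nonneg (by linarith)]
      refine (hlip1 r r' h0 h1 (by linarith) θ).trans ?_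
      rw [mul_comm]
      have : 0 < ρ - q := by linarith
      have : 0 ≤ r' - r := by linarith
      gcongr
      linarith
    intro q r r' hq h0 h1 h2 h3 θ
    rcases le_total r r' with hh | hh
    · exact key q r r' hq h0 hh h3 θ
    · have := key q r' r hq h2 hh h1 θ
      rw [abs_sub_comm, abs_sub_comm r' r]; exact this
  have hcw : ∀ θ, ∀ r ∈ Icc 0 ρ, ContinuousWithinAt (fun r => h r θ) (Icc 0 ρ) r := by
    intro θ r hr
    rcases hr.2.eq_or_lt with e | hlt
    · subst e
      rcases hr.1.eq_or_lt with e0 | hr0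
      · rw [← e0, Icc_self]; exact continuousWithinAt_singleton
      rw [Metric.continuousWithinAt_iff]
      intro ε hε
      by_contra hcon
      push Not at hcon
      obtain ⟨x, hx, hxc⟩ := nested (c := h ρ θ + ε) (θ := θ) hb hp hr0 (fun q hq hq' => by
        obtain ⟨q', hq'm, hd, hge⟩ := hcon (ρ - q) (by linarith)
        rw [Real.dist_eq] at hd hge
        have h1 := hmono q' ρ hq'm.1 hq'm.2 le_rfl θ
        rw [abs_of_nonneg (by linarith)] at hge
        have h2 : q ≤ q' := by have := (abs_lt.1 hd).1; linarith
        have h3 := hmono q q' hq h2 hq'm.2 θ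
        obtain ⟨x, hx, e⟩ := (hs q ⟨hq, hq'.le⟩ θ).1
        exact ⟨x, hx, by linarith⟩)
      have := (hs ρ hr θ).2 x hx
      linarith
    · have hq : (r + ρ) / 2 < ρ := by linarith
      rw [ContinuousWithinAt, tendsto_iff_norm_sub_tendsto_zero]
      have lim : Tendsto (fun r' => 4 * R / (ρ - (r + ρ) / 2) * |r - r'|) (𝓝[Icc 0 ρ] r) (𝓝 0) := by
        have : Continuous (fun r' => 4 * R / (ρ - (r + ρ) / 2) * |r - r'|) := by fun_prop
        have := this.tendsto r
        simp only [sub_self, abs_zero, mul_zero] at this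
        exact this.mono_left nhdsWithin_le_nhds
      refine squeeze_zero' (Eventually.of_forall fun _ => norm_nonneg _) ?_ lim
      have : ∀ᶠ r' in 𝓝[Icc 0 ρ] r, r' < (r + ρ) / 2 :=
        nhdsWithin_le_nhds (Iio_mem_nhds (by linarith))
      filter_upwards [this, self_mem_nhdsWithin] with r' h1 h2
      exact hlip _ r' r hq h2.1 h1.le hr.1 (by linarith) θ
  have hJ : ∀ w : ℝ → ℝ, Continuous w → ContinuousOn (fun r => ∫ θ in (0:ℝ)..2 * π, h r θ * w θ) (Icc 0 ρ) := by
    intro w hw r hr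
    apply intervalIntegral.continuousWithinAt_of_dominated_interval (bound := fun θ => 2 * R * |w θ|)
    · filter_upwards [self_mem_nhdsWithin] with r' hr'
      exact ((hcont r' hr').mul hw).aestronglyMeasurable
    · filter_upwards [self_mem_nhdsWithin] with r' hr'
      refine Eventually.of_forall fun θ _ => ?_
      rw [norm_mul]
      exact mul_le_mul_of_nonneg_right ((hs r' hr').bd (hbr r' hr'.1) θ) (abs_nonneg _)
    · exact Continuous.intervalIntegrable (by fun_prop) _ _
    · exact Eventually.of_forall fun θ _ => (hcw θ r hr).mul continuousWithinAt_const
  set L : ℝ → ℝ := fun r => ∫ θ in (0:ℝ)..2 * π, h r θ * rho a θ with hL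
  set A : ℝ → ℝ := fun r => (1/2) * ∫ θ in (0:ℝ)..2 * π, h r θ * rho (kr g a r) θ with hA
  have hLc : ContinuousOn L (Icc 0 ρ) := hJ _ (rho_cont ha)
  have hAe : ∀ r ∈ Icc 0 ρ, A r = (1/2) * ((∫ θ in (0:ℝ)..2 * π, h r θ * rho g θ) - r * L r) := by
    intro r hr
    have c1 := hcont r hr
    have c2 := rho_cont ha
    have c3 := rho_cont hg
    simp only [hA, hL]
    rw [← intervalIntegral.integral_const_mul r, ← intervalIntegral.integral_sub]
    · congr 2; ext θ; unfold kr; rw [rho_add_mul hg ha]; ring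
    all_goals exact Continuous.intervalIntegrable (by fun_prop) _ _
  have hAc : ContinuousOn A (Icc 0 ρ) := by
    refine ContinuousOn.congr ?_ hAe
    exact continuousOn_const.mul ((hJ _ (rho_cont hg)).sub (continuousOn_id.mul hLc))
  have hmain : ∀ r ∈ Icc 0 ρ, ∀ r' ∈ Icc 0 ρ, A r' ≤ A r - (r' - r) * L r +
      (1/2) * ∫ θ in (0:ℝ)..2 * π, (h r θ - h r' θ) ^ 2 := by
    intro r hr r' hr'
    exact main_ineq hR (kr_nice hg ha r) (kr_nice hg ha r') ha (fun θ => by simp only [kr]; ring)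
      (hs r hr) (hbr r hr.1) (hs r' hr') (hbr r' hr'.1)
  have hder : ∀ r ∈ Ioo 0 ρ, HasDerivAt A (-L r) r := by
    intro r hr
    have hrm : r ∈ Icc 0 ρ := ⟨hr.1.le, hr.2.le⟩
    have hq : (r + ρ) / 2 < ρ := by linarith [hr.2]
    obtain ⟨Ca, hCa, hCab⟩ := per_bdd (rho_cont ha) (rho_per ha)
    set C := 4 * R / (ρ - (r + ρ) / 2) with hC
    have hC0 : 0 ≤ C := by
      have : 0 < ρ - (r + ρ) / 2 := by linarith
      positivity
    rw [hasDerivAt_iff_isLittleO]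
    have big : (fun r' => A r' - A r - (r' - r) • (-L r)) =O[𝓝 r] fun r' => ‖r' - r‖ ^ 2 := by
      apply Asymptotics.IsBigO.of_bound (C ^ 2 * π + C * Ca * (2 * π))
      filter_upwards [Ioo_mem_nhds hr.1 (show r < (r + ρ) / 2 by linarith [hr.2])] with r' hr'
      have hr'm : r' ∈ Icc 0 ρ := ⟨hr'.1.le, by linarith [hr'.2]⟩
      have hl := hlip _ r r' hq hr.1.le (by linarith [hr.2]) hr'.1.le hr'.2.le
      have i1 := hmain r hrm r' hr'm
      have i2 := hmain r' hr'm r hrm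
      have Qe : ∫ θ in (0:ℝ)..2 * π, (h r' θ - h r θ) ^ 2 = ∫ θ in (0:ℝ)..2 * π, (h r θ - h r' θ) ^ 2 := by
        congr 1; ext θ; ring
      rw [Qe] at i2
      set Q := ∫ θ in (0:ℝ)..2 * π, (h r θ - h r' θ) ^ 2
      have Qb : Q ≤ (C * |r' - r|) ^ 2 * (2 * π) := by
        have := intervalIntegral.norm_integral_le_of_norm_le_const (a := (0:ℝ)) (b := 2 * π)
          (f := fun θ => (h r θ - h r' θ) ^ 2) (C := (C * |r' - r|) ^ 2) (fun θ _ => by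
            rw [norm_pow, Real.norm_eq_abs]
            gcongr
            exact hl θ)
        rw [sub_zero, abs_of_pos (by positivity : (0:ℝ) < 2 * π)] at this
        exact (le_abs_self _).trans this
      have Lb : |L r - L r'| ≤ C * |r' - r| * Ca * (2 * π) := by
        have e : L r - L r' = ∫ θ in (0:ℝ)..2 * π, (h r θ - h r' θ) * rho a θ := by
          have c1 := hcont r hrm
          have c1' := hcont r' hr'm
          have c2 := rho_cont ha
          simp only [hL]
          rw [← intervalIntegral.integral_sub]
          · congr 1; ext θ; ring
          all_goals exact Continuous.intervalIntegrable (by fun_prop) _ _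
        rw [e]
        have := intervalIntegral.norm_integral_le_of_norm_le_const (a := (0:ℝ)) (b := 2 * π)
          (f := fun θ => (h r θ - h r' θ) * rho a θ) (C := C * |r' - r| * Ca) (fun θ _ => by
            rw [norm_mul, Real.norm_eq_abs, Real.norm_eq_abs]
            gcongr
            · exact hl θ
            · exact hCab θ)
        rwa [sub_zero, abs_of_pos (by positivity : (0:ℝ) < 2 * π)] at this
      have Pb : |(r' - r) * (L r - L r')| ≤ |r' - r| * (C * |r' - r| * Ca * (2 * π)) := by
        rw [abs_mul]; gcongr
      have Pb' := abs_le.1 Pb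
      have tn : 0 ≤ |r' - r| * (C * |r' - r| * Ca * (2 * π)) := by positivity
      rw [norm_pow, norm_norm, Real.norm_eq_abs, Real.norm_eq_abs, smul_eq_mul, abs_le]
      constructor <;> nlinarith
    exact big.trans_isLittleO (Asymptotics.isLittleO_pow_sub_sub r (by norm_num))
  have hint : IntervalIntegrable (fun r => -L r) volume 0 ρ := by
    apply ContinuousOn.intervalIntegrable
    rw [uIcc_of_le hρ0]
    exact hLc.neg
  have ftc := intervalIntegral.integral_eq_sub_of_hasDerivAt_of_le hρ0 hAc hder hint
  have hAρ : A ρ = 0 := by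
    have hi : ¬ (interior (Wu (kr g a ρ))).Nonempty := by
      intro hne
      obtain ⟨x, s, hs0, hx⟩ := wu_interior_conv ha hne
      have : ρ + s ∈ Rset g a := ⟨by linarith, x, fun θ => by
        have := hx θ
        simp only [kr] at this ⊢
        linarith⟩
      have := le_csSup hbd this
      linarith
    obtain ⟨n1, n2, c, hn, hfl⟩ := flat_of_empty (wu_convex _) ⟨x0, hx0⟩ hi
    simp only [hA]
    rw [degen hR (kr_nice hg ha ρ) (hs ρ ⟨hρ0, le_rfl⟩) (hbr ρ hρ0) (hcomp ρ hρ0) hn hfl, mul_zero]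
  have hA0 : A 0 = (1/2) * (∫ θ in (0:ℝ)..2 * π, g θ * rho g θ) := by
    have h0 := hs 0 ⟨le_rfl, hρ0⟩
    simp only [hA]
    rw [kr_zero] at h0 ⊢
    rw [h0.uniq hgs]
  refine ⟨L, fun r hr h' hs' => ?_, ?_⟩
  · rw [hs'.uniq (hs r hr)]
  · rw [← hA0]
    rw [intervalIntegral.integral_neg, hAρ] at ftc
    linarith

end part4

section part5
open Filter Topology

open scoped Pointwise

lemma polar_er (v : ℝ × ℝ) : ∃ t θ : ℝ, 0 ≤ t ∧ v = t • er θ := by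
  refine ⟨‖(⟨v.1, v.2⟩ : ℂ)‖, Complex.arg ⟨v.1, v.2⟩, norm_nonneg _, ?_⟩
  ext
  · simp [er, Complex.norm_mul_cos_arg]
  · simp [er, Complex.norm_mul_sin_arg]

lemma polar_eth (v : ℝ × ℝ) : ∃ t θ : ℝ, 0 ≤ t ∧ v = t • eth θ := by
  obtain ⟨t, θ, ht, e⟩ := polar_er v
  refine ⟨t, θ - π / 2, ht, ?_⟩
  rw [e]; simp [er, eth, sin_sub_pi_div_two, cos_sub_pi_div_two]

def crv (k : ℝ → ℝ) (θ : ℝ) : ℝ × ℝ := k θ • er θ + deriv k θ • eth θ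

lemma er_hd (θ : ℝ) : HasDerivAt er (eth θ) θ :=
  (hasDerivAt_cos θ).prodMk (hasDerivAt_sin θ)

lemma eth_hd (θ : ℝ) : HasDerivAt eth (- er θ) θ := by
  have := (hasDerivAt_sin θ).neg.prodMk (hasDerivAt_cos θ)
  exact this

lemma crv_hd {k : ℝ → ℝ} (hk : Nice k) (θ : ℝ) : HasDerivAt (crv k) (rho k θ • eth θ) θ := by
  have := ((hk.hd θ).smul (er_hd θ)).add ((hk.deriv.hd θ).smul (eth_hd θ))
  refine HasDerivAt.congr_deriv this ?_
  simp only [rho]; module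

lemma crv_per {k : ℝ → ℝ} (hk : Nice k) : Function.Periodic (crv k) (2 * π) := by
  intro θ
  simp [crv, hk.2 θ, hk.deriv.2 θ, er, eth]

lemma dt_eth (θ ψ : ℝ) : dt (eth ψ) θ = sin (θ - ψ) := by
  simp [dt, eth, sin_sub]; ring
lemma dt_er (θ ψ : ℝ) : dt (er ψ) θ = cos (θ - ψ) := by
  simp [dt, er, cos_sub]; ring

lemma dt_crv (k : ℝ → ℝ) (θ : ℝ) : dt (crv k θ) θ = k θ := by
  simp [crv, dt_add, dt_smul, dt_er, dt_eth]

lemma dt_hd {σ : ℝ → ℝ × ℝ} {σ' : ℝ × ℝ} {t : ℝ} (h : HasDerivAt σ σ' t) (φ : ℝ) :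
    HasDerivAt (fun t => dt (σ t) φ) (dt σ' φ) t := by
  have h1 : HasDerivAt (fun t => (σ t).1) σ'.1 t := by
    have := (hasFDerivAt_fst (𝕜 := ℝ) (p := σ t)).comp_hasDerivAt t h
    exact this
  have h2 : HasDerivAt (fun t => (σ t).2) σ'.2 t := by
    have := (hasFDerivAt_snd (𝕜 := ℝ) (p := σ t)).comp_hasDerivAt t h
    exact this
  exact (h1.mul_const _).add (h2.mul_const _)

lemma curve_le {k : ℝ → ℝ} (hk : Nice k) (hr : ∀ θ, 0 ≤ rho k θ) (ψ θ : ℝ) :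
    dt (crv k ψ) θ ≤ k θ := by
  have key : ∀ ψ ∈ Ico (θ - π) (θ - π + 2 * π), dt (crv k ψ) θ ≤ k θ := by
    intro ψ hψ
    have hd : ∀ ψ, HasDerivAt (fun ψ => dt (crv k ψ) θ) (rho k ψ * sin (θ - ψ)) ψ := by
      intro ψ
      have := dt_hd (crv_hd hk ψ) θ
      rwa [dt_smul, dt_eth] at this
    have hc : Continuous (fun ψ => dt (crv k ψ) θ) :=
      continuous_iff_continuousAt.2 fun ψ => (hd ψ).continuousAt
    have hdd : ∀ ψ, deriv (fun ψ => dt (crv k ψ) θ) ψ = rho k ψ * sin (θ - ψ) := fun ψ => (hd ψ).deriv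
    rw [← dt_crv k θ]
    rcases le_total ψ θ with h | h
    · have m : MonotoneOn (fun ψ => dt (crv k ψ) θ) (Icc (θ - π) θ) := by
        apply monotoneOn_of_deriv_nonneg (convex_Icc _ _) hc.continuousOn
        · exact fun x _ => (hd x).differentiableAt.differentiableWithinAt
        · intro x hx
          rw [interior_Icc] at hx
          rw [hdd]
          exact mul_nonneg (hr x) (sin_nonneg_of_nonneg_of_le_pi (by linarith [hx.2]) (by linarith [hx.1]))
      exact m ⟨hψ.1, h⟩ ⟨by linarith [pi_pos], le_rfl⟩ h
    · have m : AntitoneOn (fun ψ => dt (crv k ψ) θ) (Icc θ (θ + π)) := by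
        apply antitoneOn_of_deriv_nonpos (convex_Icc _ _) hc.continuousOn
        · exact fun x _ => (hd x).differentiableAt.differentiableWithinAt
        · intro x hx
          rw [interior_Icc] at hx
          rw [hdd]
          exact mul_nonpos_of_nonneg_of_nonpos (hr x)
            (sin_nonpos_of_nonpos_of_neg_pi_le (by linarith [hx.1]) (by linarith [hx.2]))
      exact m ⟨le_rfl, by linarith [pi_pos]⟩ ⟨h, by linarith [hψ.2]⟩ h
  obtain ⟨y, hy, e⟩ := (crv_per hk).exists_mem_Ico (by positivity) ψ (θ - π)
  rw [e]; exact key y hy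

lemma deriv_dt_crv_eq {k l : ℝ → ℝ} (hk : Nice k) (hl : Nice l) (t θ : ℝ) (x : ℝ × ℝ)
    (h0 : k θ - dt x θ - t * l θ = 0) (hm : ∀ ψ, 0 ≤ k ψ - dt x ψ - t * l ψ) :
    crv k θ - x = t • crv l θ := by
  have dx : HasDerivAt (dt x) (x.1 * (- sin θ) + x.2 * cos θ) θ :=
    ((hasDerivAt_cos θ).const_mul _).add ((hasDerivAt_sin θ).const_mul _)
  have hd := ((hk.hd θ).sub dx).sub ((hl.hd θ).const_mul t)
  have : IsLocalMin (k - dt x - fun y => t * l y) θ := by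
    apply IsMinOn.isLocalMin (s := univ) _ univ_mem
    intro ψ _
    show k θ - dt x θ - t * l θ ≤ k ψ - dt x ψ - t * l ψ
    rw [h0]; exact hm ψ
  have h1 := this.hasDerivAt_eq_zero hd
  have hcs := sin_sq_add_cos_sq θ
  have ek : k θ = dt x θ + t * l θ := by linarith
  have ek' : deriv k θ = (x.1 * (- sin θ) + x.2 * cos θ) + t * deriv l θ := by linarith
  have hs : sin θ ^ 2 = 1 - cos θ ^ 2 := by linarith
  simp only [crv, ek, ek', dt]
  ext
  · simp [er, eth]; linear_combination x.1 * hcs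
  · simp [er, eth]; linear_combination x.2 * hcs

lemma wu_exit {k : ℝ → ℝ} (hk : Nice k) {y e : ℝ × ℝ} (hy : y ∈ Wu k) (he : ∀ θ, dt e θ ≤ 1)
    (hout : ∀ s : ℝ, 0 < s → y + s • e ∉ Wu k) : y ∈ range (crv k) := by
  have hFc : Continuous fun θ => k θ - dt y θ := hk.cont.sub (dt_cont y)
  have hFp : Function.Periodic (fun θ => k θ - dt y θ) (2 * π) := by
    intro θ; simp only [hk.2 θ, dt_per y θ]
  obtain ⟨θ, -, hm⟩ := (isCompact_Icc (a := (0:ℝ)) (b := 2 * π)).exists_isMinOn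
    ⟨0, le_rfl, by positivity⟩ hFc.continuousOn
  have hm' : ∀ ψ, k θ - dt y θ ≤ k ψ - dt y ψ := by
    intro ψ
    obtain ⟨z, hz, e⟩ := hFp.exists_mem_Ico₀ (by positivity) ψ
    have : k ψ - dt y ψ = k z - dt y z := e
    rw [this]; exact hm ⟨hz.1, hz.2.le⟩
  have h0 : 0 ≤ k θ - dt y θ := by linarith [hy θ]
  rcases h0.eq_or_lt with h | h
  · refine ⟨θ, ?_⟩
    have := deriv_dt_crv_eq hk hk 0 θ y (by linarith) (fun ψ => by linarith [hy ψ])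
    rw [zero_smul, sub_eq_zero] at this
    exact this
  · exfalso
    apply hout _ h
    intro ψ
    rw [dt_add, dt_smul]
    have := hm' ψ
    nlinarith [mul_le_mul_of_nonneg_left (he ψ) h.le]

lemma hull_eq {k : ℝ → ℝ} (hk : Nice k) (hr : ∀ θ, 0 ≤ rho k θ) :
    convexHull ℝ (range (crv k)) = Wu k := by
  apply Subset.antisymm
  · apply convexHull_min _ (wu_convex k)
    rintro _ ⟨ψ, rfl⟩ θ
    exact curve_le hk hr ψ θ
  · intro x hx
    obtain ⟨R, -, hR⟩ := wu_bd hk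
    have hcomp : IsCompact (Wu k ∩ {y | y.2 = x.2}) :=
      (bd_compact (wu_closed k) hR).inter_right (isClosed_eq continuous_snd continuous_const)
    obtain ⟨y, ⟨hy, hy2⟩, hym⟩ := hcomp.exists_isMaxOn ⟨x, hx, rfl⟩ continuous_fst.continuousOn
    obtain ⟨z, ⟨hz, hz2⟩, hzm⟩ := hcomp.exists_isMinOn ⟨x, hx, rfl⟩ continuous_fst.continuousOn
    have hy2 : y.2 = x.2 := hy2
    have hz2 : z.2 = x.2 := hz2
    have hxy : x.1 ≤ y.1 := hym ⟨hx, rfl⟩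
    have hzx : z.1 ≤ x.1 := hzm ⟨hx, rfl⟩
    have my : y ∈ range (crv k) := by
      refine wu_exit hk (e := (1, 0)) hy (fun θ => by simp [dt, cos_le_one]) fun s hs hc => ?_
      have : (y + s • ((1:ℝ), (0:ℝ))).1 ≤ y.1 := hym ⟨hc, by simp [hy2]⟩
      simp at this; linarith
    have mz : z ∈ range (crv k) := by
      refine wu_exit hk (e := (-1, 0)) hz (fun θ => by simp [dt]; linarith [neg_one_le_cos θ]) fun s hs hc => ?_
      have : z.1 ≤ (z + s • ((-1:ℝ), (0:ℝ))).1 := hzm ⟨hc, by simp [hz2]⟩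
      simp at this; linarith
    refine segment_subset_convexHull mz my ?_
    rcases (hzx.trans hxy).eq_or_lt with h | h
    · have : x = z := by ext; linarith; exact hz2.symm
      rw [this]; exact left_mem_segment _ _ _
    · refine ⟨(y.1 - x.1) / (y.1 - z.1), (x.1 - z.1) / (y.1 - z.1), div_nonneg (by linarith) (by linarith),
        div_nonneg (by linarith) (by linarith), ?_, ?_⟩
      · rw [← add_div, div_eq_one_iff_eq (by linarith)]; ring
      · have : y.1 - z.1 ≠ 0 := by linarith
        ext
        · simp; field_simp; ring
        · simp [hy2, hz2]; field_simp; ring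

lemma wu_supp {k : ℝ → ℝ} (hk : Nice k) (hr : ∀ θ, 0 ≤ rho k θ) : Supp (Wu k) k :=
  fun θ => ⟨⟨crv k θ, fun ψ => curve_le hk hr θ ψ, dt_crv k θ⟩, fun _ hx => hx θ⟩

lemma crv_mem {k : ℝ → ℝ} (hk : Nice k) (hr : ∀ θ, 0 ≤ rho k θ) (θ : ℝ) : crv k θ ∈ Wu k :=
  fun ψ => curve_le hk hr θ ψ

lemma det2_crv (k : ℝ → ℝ) (θ ψ : ℝ) : det2 (crv k θ) (eth ψ) = dt (crv k θ) ψ := by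
  simp [det2, dt, eth]

lemma det2_smul (x y : ℝ × ℝ) (c : ℝ) : det2 x (c • y) = c * det2 x y := by
  simp [det2]; ring
lemma det2_add (x y z : ℝ × ℝ) : det2 x (y + z) = det2 x y + det2 x z := by
  simp [det2]; ring

lemma rset_eq {g a : ℝ → ℝ} (ha : Nice a) (hra : ∀ θ, 0 ≤ rho a θ) :
    {r : ℝ | 0 ≤ r ∧ ∃ x : ℝ × ℝ, (fun y => x + r • y) '' (Wu a) ⊆ Wu g} = Rset g a := by
  ext r
  simp only [Rset, mem_ofPred_eq]
  refine and_congr_right fun hr => ?_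
  constructor
  · rintro ⟨x, hx⟩
    refine ⟨x, fun θ => ?_⟩
    have := hx ⟨crv a θ, crv_mem ha hra θ, rfl⟩ θ
    simp only [dt_add, dt_smul, dt_crv] at this
    simp only [kr]; linarith
  · rintro ⟨x, hx⟩
    refine ⟨x, ?_⟩
    rintro _ ⟨y, hy, rfl⟩ θ
    have h1 := hx θ
    have h2 := mul_le_mul_of_nonneg_left (hy θ) hr
    simp only [dt_add, dt_smul]
    simp only [kr] at h1; linarith

lemma crv_pi {a : ℝ → ℝ} (hs : ∀ θ, a (θ + π) = a θ) (θ : ℝ) : crv a (θ + π) = - crv a θ := by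
  have : deriv a (θ + π) = deriv a θ := by
    have : (fun x => a (x + π)) = a := funext hs
    rw [← deriv_comp_add_const, this]
  simp [crv, this, hs, er, eth]
  constructor <;> ring

lemma rho_pi {a : ℝ → ℝ} (hs : ∀ θ, a (θ + π) = a θ) (θ : ℝ) : rho a (θ + π) = rho a θ := by
  have h1 : ∀ θ, deriv a (θ + π) = deriv a θ := by
    intro θ
    have : (fun x => a (x + π)) = a := funext hs
    rw [← deriv_comp_add_const, this]
  have : deriv (deriv a) (θ + π) = deriv (deriv a) θ := by
    have : (fun x => deriv a (x + π)) = deriv a := funext h1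
    rw [← deriv_comp_add_const, this]
  simp [rho, this, hs]

lemma inner_eq {g a : ℝ → ℝ} (hg : Nice g) (ha : Nice a) (hp : ∀ θ, 0 < a θ)
    (hra : ∀ θ, 0 ≤ rho a θ) (hs : ∀ θ, a (θ + π) = a θ) {r : ℝ} (hr : 0 ≤ r) :
    {x ∈ Wu g | ∀ y ∈ range (crv g), r ≤ gauge (Wu a) (x - y)} = Wu (kr g a r) := by
  have habs : Absorbent ℝ (Wu a) := by
    apply absorbent_nhds_zero
    rw [← mem_interior_iff_mem_nhds]
    exact wu_interior ha hp one_pos (by intro θ; simp [dt])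
  ext x
  constructor
  · rintro ⟨hx, hy⟩
    by_contra hn
    simp only [Wu, mem_ofPred_eq, not_forall, not_le, kr] at hn
    obtain ⟨ψ, hψ⟩ := hn
    have hFc : Continuous fun θ => (g θ - dt x θ) / a θ :=
      (hg.cont.sub (dt_cont x)).div ha.cont fun θ => (hp θ).ne'
    have hFp : Function.Periodic (fun θ => (g θ - dt x θ) / a θ) (2 * π) := by
      intro θ; simp only [hg.2 θ, ha.2 θ, dt_per x θ]
    obtain ⟨θ, -, hm⟩ := (isCompact_Icc (a := (0:ℝ)) (b := 2 * π)).exists_isMinOn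
      ⟨0, le_rfl, by positivity⟩ hFc.continuousOn
    have hm' : ∀ ψ, (g θ - dt x θ) / a θ ≤ (g ψ - dt x ψ) / a ψ := by
      intro ψ
      obtain ⟨y, hy, e⟩ := hFp.exists_mem_Ico₀ (by positivity) ψ
      have : (g ψ - dt x ψ) / a ψ = (g y - dt x y) / a y := e
      rw [this]; exact hm ⟨hy.1, hy.2.le⟩
    set t := (g θ - dt x θ) / a θ with ht
    have ht0 : 0 ≤ t := div_nonneg (by linarith [hx θ]) (hp θ).le
    have htr : t < r := by
      refine (hm' ψ).trans_lt ?_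
      rw [div_lt_iff₀ (hp ψ)]; linarith
    have e := deriv_dt_crv_eq hg ha t θ x (by rw [ht, div_mul_cancel₀ _ (hp θ).ne']; ring) (fun ψ => by
      have := (le_div_iff₀ (hp ψ)).1 (hm' ψ); linarith)
    have h1 := hy _ (mem_range_self θ)
    have e2 : x - crv g θ = t • crv a (θ + π) := by
      rw [crv_pi hs, smul_neg, ← e]; abel
    have h2 : gauge (Wu a) (x - crv g θ) ≤ t := gauge_le_of_mem ht0 (by
      rw [e2]; exact smul_mem_smul_set (crv_mem ha hra _))
    linarith
  · intro hx
    refine ⟨fun θ => ?_, ?_⟩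
    · have := hx θ
      simp only [kr] at this
      nlinarith [hp θ]
    · rintro _ ⟨θ, rfl⟩
      by_contra hn
      push Not at hn
      obtain ⟨b, hb, hbr, z, hz, e⟩ := exists_lt_of_gauge_lt habs hn
      have h1 := hx θ
      have h2 := hz (θ + π)
      have h3 : dt (x - crv g θ) (θ + π) = b * dt z (θ + π) := by
        rw [← e]; exact dt_smul _ _ _
      rw [dt_pi, dt_sub, dt_crv] at h3
      rw [hs] at h2
      simp only [kr] at h1
      nlinarith [hp θ, mul_le_mul_of_nonneg_left h2 hb.le]

lemma gauge_q {a : ℝ → ℝ} (ha : Nice a) (hp : ∀ θ, 0 < a θ) (hra : ∀ θ, 0 ≤ rho a θ) {t : ℝ} (ht : 0 ≤ t) (θ : ℝ) :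
    gauge (convexHull ℝ (range fun θ => (a θ)⁻¹ • eth θ)) (t • eth θ) = t * a θ := by
  set Q := convexHull ℝ (range fun θ => (a θ)⁻¹ • eth θ) with hQ
  have hmem : t • eth θ ∈ (t * a θ) • Q := by
    have : t • eth θ = (t * a θ) • ((a θ)⁻¹ • eth θ) := by
      rw [smul_smul, mul_assoc, mul_inv_cancel₀ (hp θ).ne', mul_one]
    rw [this]
    exact smul_mem_smul_set (subset_convexHull ℝ _ ⟨θ, rfl⟩)
  apply le_antisymm
  · exact gauge_le_of_mem (mul_nonneg ht (hp θ).le) hmem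
  rcases ht.eq_or_lt with h0 | h0
  · simp [← h0]
  rw [gauge_def]
  apply le_csInf
  · exact ⟨t * a θ, mul_pos h0 (hp θ), hmem⟩
  rintro b ⟨hb, z, hz, e⟩
  have hb : 0 < b := hb
  have hz1 : det2 (crv a θ) z ≤ 1 := by
    have : Q ⊆ {z | det2 (crv a θ) z ≤ 1} := by
      apply convexHull_min
      · rintro _ ⟨ψ, rfl⟩
        show det2 _ _ ≤ 1
        rw [det2_smul, det2_crv, inv_mul_le_iff₀ (hp ψ), mul_one]
        exact curve_le ha hra θ ψ
      · intro x hx y hy c d hc hd hcd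
        simp only [mem_ofPred_eq, det2_add, det2_smul] at *
        nlinarith
    exact this hz
  have h3 : det2 (crv a θ) (t • eth θ) = b * det2 (crv a θ) z := by
    rw [← e]; exact det2_smul _ _ _
  rw [det2_smul, det2_crv, dt_crv] at h3
  rw [h3]; nlinarith

end part5

section part6
open Filter Topology

lemma a_int {a : ℝ → ℝ} (ha : Nice a) (hs : ∀ θ, a (θ + π) = a θ) (θ : ℝ) :
    ∫ φ in (0:ℝ)..2 * π, |sin (φ - θ)| * rho a φ = 4 * a θ := by
  have hrc := rho_cont ha
  have fc : Continuous fun φ => |sin (φ - θ)| * rho a φ := by fun_prop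
  have fpi : ∀ φ, |sin (φ + π - θ)| * rho a (φ + π) = |sin (φ - θ)| * rho a φ := by
    intro φ
    rw [rho_pi hs, show φ + π - θ = φ - θ + π by ring, sin_add_pi, abs_neg]
  have fp : Function.Periodic (fun φ => |sin (φ - θ)| * rho a φ) (2 * π) := by
    intro φ
    show |sin (φ + 2 * π - θ)| * rho a (φ + 2 * π) = |sin (φ - θ)| * rho a φ
    rw [show φ + 2 * π = φ + π + π by ring, fpi, fpi]
  have e1 := fp.intervalIntegral_add_eq 0 θ
  rw [zero_add] at e1
  rw [e1, ← intervalIntegral.integral_add_adjacent_intervals (b := θ + π)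
    (fc.intervalIntegrable _ _) (fc.intervalIntegrable _ _)]
  have e2 : ∫ φ in (θ + π)..(θ + 2 * π), |sin (φ - θ)| * rho a φ = ∫ φ in θ..(θ + π), |sin (φ - θ)| * rho a φ := by
    rw [show θ + 2 * π = (θ + π) + π by ring,
      ← intervalIntegral.integral_comp_add_right (fun φ => |sin (φ - θ)| * rho a φ) π]
    simp only [fpi]
  have e3 : ∫ φ in θ..(θ + π), |sin (φ - θ)| * rho a φ = 2 * a θ := by
    have c1 : ∫ φ in θ..(θ + π), |sin (φ - θ)| * rho a φ = ∫ φ in θ..(θ + π), sin (φ - θ) * rho a φ := by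
      apply intervalIntegral.integral_congr
      intro φ hφ
      rw [uIcc_of_le (by linarith [pi_pos])] at hφ
      simp only
      rw [abs_of_nonneg (sin_nonneg_of_nonneg_of_le_pi (by linarith [hφ.1]) (by linarith [hφ.2]))]
    rw [c1]
    rw [intervalIntegral.integral_eq_sub_of_hasDerivAt
      (f := fun φ => sin (φ - θ) * deriv a φ - cos (φ - θ) * a φ)]
    · simp [hs]; ring
    · intro φ _
      have s1 : HasDerivAt (fun φ => sin (φ - θ)) (cos (φ - θ)) φ := (hasDerivAt_sin _).comp_sub_const φ θ
      have s2 : HasDerivAt (fun φ => cos (φ - θ)) (- sin (φ - θ)) φ := (hasDerivAt_cos _).comp_sub_const φ θ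
      refine ((s1.mul (ha.deriv.hd φ)).sub (s2.mul (ha.hd φ))).congr_deriv ?_
      simp only [rho]; ring
    · exact Continuous.intervalIntegrable (by fun_prop) _ _
  rw [e2, e3]; ring

lemma gauge_int {a : ℝ → ℝ} (ha : Nice a) (hp : ∀ θ, 0 < a θ) (hra : ∀ θ, 0 ≤ rho a θ)
    (hs : ∀ θ, a (θ + π) = a θ) (v : ℝ × ℝ) :
    gauge (convexHull ℝ (range fun θ => (a θ)⁻¹ • eth θ)) v =
      (1 / 4) * ∫ φ in (0:ℝ)..2 * π, |dt v φ| * rho a φ := by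
  obtain ⟨t, θ, ht, rfl⟩ := polar_eth v
  rw [gauge_q ha hp hra ht]
  have : ∀ φ, |dt (t • eth θ) φ| * rho a φ = t * (|sin (φ - θ)| * rho a φ) := by
    intro φ
    rw [dt_smul, dt_eth, abs_mul, abs_of_nonneg ht]; ring
  simp only [this]
  rw [intervalIntegral.integral_const_mul, a_int ha hs]; ring

lemma mono1 {u : ℝ → ℝ} {m M t0 t1 : ℝ} (hc : Continuous u) (hm : ∀ t, m ≤ u t) (hM : ∀ t, u t ≤ M)
    (h0 : u t0 = m) (h1 : u t1 = M) (h2 : t1 < t0 + 2 * π)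
    (H : ∀ x y z, x < y → y < z → z < x + 2 * π → u x = u y → u y = u z → m < u y → u y < M → False) :
    MonotoneOn u (Icc t0 t1) := by
  intro x hx y hy hxy
  by_contra hn
  push Not at hn
  have hxy : x < y := lt_of_le_of_ne hxy (by rintro rfl; exact lt_irrefl _ hn)
  obtain ⟨l, hl1, hl2⟩ := exists_between hn
  have k1 := hm y
  have k2 := hM x
  obtain ⟨p, hp, ep⟩ := intermediate_value_Ioo hx.1 hc.continuousOn (show l ∈ Ioo (u t0) (u x) from ⟨by linarith, hl2⟩)
  obtain ⟨q, hq, eq⟩ := intermediate_value_Ioo' hxy.le hc.continuousOn (show l ∈ Ioo (u y) (u x) from ⟨hl1, hl2⟩)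
  obtain ⟨r, hr, er⟩ := intermediate_value_Ioo hy.2 hc.continuousOn (show l ∈ Ioo (u y) (u t1) from ⟨hl1, by linarith⟩)
  exact H p q r (hp.2.trans hq.1) (hq.2.trans hr.1) (by linarith [hp.1, hr.2]) (by rw [ep, eq]) (by rw [eq, er])
    (by rw [eq]; linarith) (by rw [eq]; linarith)

lemma mono_int {u : ℝ → ℝ} {C : NNReal} {s t : ℝ} (hst : s ≤ t) (hl : LipschitzWith C u) (hm : MonotoneOn u (Icc s t)) :
    ∫ x in s..t, |deriv u x| = u t - u s := by
  rw [← (hl.lipschitzOnWith (s := uIcc s t)).absolutelyContinuousOnInterval.integral_deriv_eq_sub]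
  apply intervalIntegral.integral_congr_Ioo_of_le hst
  intro x hx
  have : 0 ≤ deriv u x := by
    rw [← derivWithin_of_mem_nhds (Icc_mem_nhds hx.1 hx.2)]
    exact hm.derivWithin_nonneg
  exact abs_of_nonneg this

lemma updown {u : ℝ → ℝ} {C : NNReal} {m M t0 t1 : ℝ} (hl : LipschitzWith C u) (hp : Function.Periodic u (2 * π))
    (hm : ∀ t, m ≤ u t) (hM : ∀ t, u t ≤ M)
    (h0 : u t0 = m) (h1 : u t1 = M) (h01 : t0 < t1) (h2 : t1 < t0 + 2 * π)
    (H : ∀ x y z, x < y → y < z → z < x + 2 * π → u x = u y → u y = u z → m < u y → u y < M → False) :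
    ∫ x in (0:ℝ)..2 * π, |deriv u x| = 2 * (M - m) := by
  have hc := hl.continuous
  have m1 := mono1 hc hm hM h0 h1 h2 H
  have m2 : MonotoneOn (-u) (Icc t1 (t0 + 2 * π)) := by
    refine mono1 (m := -M) (M := -m) hc.neg (fun t => neg_le_neg (hM t)) (fun t => neg_le_neg (hm t))
      (by simp [h1]) (by simp [hp t0, h0]) (by linarith) ?_
    intro x y z a b c d e f g
    simp only [Pi.neg_apply, neg_inj, neg_lt_neg_iff] at d e f g
    exact H x y z a b c d e g f
  have hln : LipschitzWith C (-u) := hl.neg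
  have i1 := mono_int h01.le hl m1
  have i2 := mono_int h2.le hln m2
  have dn : ∀ x, |deriv (-u) x| = |deriv u x| := by
    intro x; rw [deriv.neg, abs_neg]
  simp only [dn] at i2
  have dper : Function.Periodic (fun x => |deriv u x|) (2 * π) := by
    intro x
    have : (fun y => u (y + 2 * π)) = u := funext hp
    simp only
    rw [← deriv_comp_add_const, this]
  have e1 := dper.intervalIntegral_add_eq 0 t0
  rw [zero_add] at e1
  have hint : ∀ s t, IntervalIntegrable (fun x => |deriv u x|) volume s t := by
    intro s t
    apply (intervalIntegrable_const (c := (C : ℝ))).mono_fun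
    · exact (measurable_deriv u).abs.aestronglyMeasurable
    · refine Eventually.of_forall fun x => ?_
      have := norm_deriv_le_of_lipschitz (x₀ := x) hl
      simpa using this
  rw [e1, ← intervalIntegral.integral_add_adjacent_intervals (hint t0 t1) (hint _ _), i1, i2]
  simp only [Pi.neg_apply, hp t0, h0, h1]; ring

lemma dt_decomp (y : ℝ × ℝ) (φ : ℝ) : y = dt y φ • er φ + dt y (φ + π / 2) • eth φ := by
  have hcs := sin_sq_add_cos_sq φ
  ext
  · simp [dt, er, eth, cos_add_pi_div_two, sin_add_pi_div_two]; linear_combination (-y.1) * hcs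
  · simp [dt, er, eth, cos_add_pi_div_two, sin_add_pi_div_two]; linear_combination (-y.2) * hcs

lemma int_lt {W : Set (ℝ × ℝ)} {h : ℝ → ℝ} (hs : Supp W h) {x : ℝ × ℝ} (hx : x ∈ interior W) (φ : ℝ) :
    dt x φ < h φ := by
  have hc : Continuous fun s : ℝ => x + s • er φ := by fun_prop
  have : (fun s : ℝ => x + s • er φ) ⁻¹' (interior W) ∈ 𝓝 (0:ℝ) :=
    hc.continuousAt.preimage_mem_nhds (by simpa using isOpen_interior.mem_nhds hx)
  obtain ⟨δ, hδ, hb⟩ := Metric.mem_nhds_iff.1 this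
  have := (hs φ).2 _ (interior_subset (hb (show δ / 2 ∈ Metric.ball (0:ℝ) δ by
    simp [abs_of_pos hδ]; linarith)))
  simp only [dt_add, dt_smul, dt_er, sub_self, cos_zero] at this
  linarith

lemma level_int {W : Set (ℝ × ℝ)} (hcv : Convex ℝ W) {w x : ℝ × ℝ} {φ l : ℝ} (hw : w ∈ interior W) (hx : x ∈ W)
    (h : (dt w φ < l ∧ l < dt x φ) ∨ (dt x φ < l ∧ l < dt w φ)) : ∃ y ∈ interior W, dt y φ = l := by
  have hne : dt x φ - dt w φ ≠ 0 := by rcases h with h | h <;> (intro; linarith [h.1, h.2])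
  refine ⟨((dt x φ - l) / (dt x φ - dt w φ)) • w + ((l - dt w φ) / (dt x φ - dt w φ)) • x,
    hcv.openSegment_interior_self_subset_interior hw hx ⟨_, _, ?_, ?_, ?_, rfl⟩, ?_⟩
  · rcases h with h | h
    · exact div_pos (by linarith) (by linarith)
    · exact div_pos_of_neg_of_neg (by linarith) (by linarith)
  · rcases h with h | h
    · exact div_pos (by linarith) (by linarith)
    · exact div_pos_of_neg_of_neg (by linarith) (by linarith)
  · field_simp; ring
  · rw [dt_add, dt_smul, dt_smul]; field_simp; ring

lemma no2 {W : Set (ℝ × ℝ)} (hcv : Convex ℝ W) (hcl : IsClosed W) {w A B : ℝ × ℝ} {φ τ : ℝ} (hw : w ∈ interior W)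
    (hA : A ∈ frontier W) (hB : B ∈ frontier W) (eA : dt A φ = dt w φ) (eB : dt B φ = dt w φ)
    (h0 : 0 < τ) (h1 : τ < 1) (hτ : dt (A - w) (φ + π / 2) = τ * dt (B - w) (φ + π / 2)) : False := by
  have hA' := dt_decomp (A - w) φ
  have hB' := dt_decomp (B - w) φ
  rw [dt_sub A w φ, eA, sub_self, zero_smul, zero_add] at hA'
  rw [dt_sub B w φ, eB, sub_self, zero_smul, zero_add] at hB'
  have e : A - w = τ • (B - w) := by
    rw [hA', hτ, mul_smul, ← hB']
  have : A ∈ interior W := by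
    apply hcv.openSegment_interior_self_subset_interior hw (hcl.frontier_subset hB)
    refine ⟨1 - τ, τ, by linarith, h0, by ring, ?_⟩
    rw [eq_add_of_sub_eq e]; module
  exact hA.2 this

lemma neg2 {W : Set (ℝ × ℝ)} (hcv : Convex ℝ W) (hcl : IsClosed W) {w A B : ℝ × ℝ} {φ : ℝ} (hw : w ∈ interior W)
    (hA : A ∈ frontier W) (hB : B ∈ frontier W) (eA : dt A φ = dt w φ) (eB : dt B φ = dt w φ) (hAB : A ≠ B) :
    dt (A - w) (φ + π / 2) * dt (B - w) (φ + π / 2) < 0 := by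
  have nz : ∀ A ∈ frontier W, dt A φ = dt w φ → dt (A - w) (φ + π / 2) ≠ 0 := by
    intro A hA eA h0
    have hA' := dt_decomp (A - w) φ
    rw [dt_sub A w φ, eA, h0, sub_self, zero_smul, zero_smul, add_zero, sub_eq_zero] at hA'
    rw [hA'] at hA; exact hA.2 hw
  have nA := nz A hA eA
  have nB := nz B hB eB
  set s := dt (A - w) (φ + π / 2) with hs
  set t := dt (B - w) (φ + π / 2) with ht
  by_contra hn
  have hpos : 0 < s * t := lt_of_le_of_ne (not_lt.1 hn) (mul_ne_zero nA nB).symm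
  have hst : 0 < s / t := by
    have : s / t = (s * t) / t ^ 2 := by field_simp
    rw [this]; positivity
  rcases lt_trichotomy (s / t) 1 with h | h | h
  · exact no2 hcv hcl hw hA hB eA eB hst h (by rw [← hs, ← ht]; field_simp)
  · rw [div_eq_one_iff_eq nB] at h
    apply hAB
    have hA' := dt_decomp (A - w) φ
    have hB' := dt_decomp (B - w) φ
    rw [dt_sub A w φ, eA] at hA'
    rw [dt_sub B w φ, eB, ← ht, ← h, hs, ← hA'] at hB'
    exact (sub_left_inj.1 hB').symm
  · have h' : t / s < 1 := by rw [← inv_div]; exact inv_lt_one_of_one_lt₀ h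
    exact no2 hcv hcl hw hB hA eB eA (by rw [← inv_div]; exact inv_pos.2 hst) h' (by rw [← hs, ← ht]; field_simp)

lemma inj_window {c : ℝ → ℝ × ℝ} (hp : Function.Periodic c (2 * π)) (hi : InjOn c (Ico 0 (2 * π))) {s t : ℝ}
    (h1 : s < t) (h2 : t < s + 2 * π) : c s ≠ c t := by
  intro e
  have h2p : (0:ℝ) < 2 * π := by positivity
  have hm : ∀ s, c (toIcoMod h2p 0 s) = c s := fun s => by
    rw [toIcoMod]; exact hp.sub_zsmul_eq _
  have := hi (by simpa using toIcoMod_mem_Ico h2p 0 s) (by simpa using toIcoMod_mem_Ico h2p 0 t)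
    (by rw [hm, hm, e])
  simp only [toIcoMod, zsmul_eq_mul] at this
  have e2 : t - s = ((toIcoDiv h2p 0 t - toIcoDiv h2p 0 s : ℤ) : ℝ) * (2 * π) := by
    push_cast; linarith
  set n : ℤ := toIcoDiv h2p 0 t - toIcoDiv h2p 0 s
  have n0 : (0:ℝ) < n := by
    by_contra hn
    push Not at hn
    nlinarith
  have n1 : (n:ℝ) < 1 := by
    by_contra hn
    push Not at hn
    nlinarith
  have n0 : 0 < n := by exact_mod_cast n0
  have n1 : n < 1 := by exact_mod_cast n1
  omega

lemma dt_norm (v : ℝ × ℝ) (φ : ℝ) : |dt v φ| ≤ 2 * ‖v‖ :=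
  dt_bd ⟨norm_fst_le v, norm_snd_le v⟩ φ

lemma width {W : Set (ℝ × ℝ)} {h : ℝ → ℝ} (hcv : Convex ℝ W) (hcl : IsClosed W) (hs : Supp W h)
    (hne : (interior W).Nonempty) {c : ℝ → ℝ × ℝ} (hp : Function.Periodic c (2 * π)) (hr : range c = frontier W)
    {C : NNReal} (hl : LipschitzWith C c) (hi : InjOn c (Ico 0 (2 * π))) (φ : ℝ) :
    ∫ t in (0:ℝ)..2 * π, |dt (deriv c t) φ| = 2 * (h φ + h (φ + π)) := by
  obtain ⟨w0, hw0⟩ := hne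
  have fr : ∀ ψ, ∃ t, dt (c t) ψ = h ψ := by
    intro ψ
    obtain ⟨x, hx, e⟩ := (hs ψ).1
    have : x ∈ frontier W := ⟨subset_closure hx, fun hi => by linarith [int_lt hs hi ψ]⟩
    rw [← hr] at this
    obtain ⟨t, rfl⟩ := this
    exact ⟨t, e⟩
  have cf : ∀ t, c t ∈ frontier W := fun t => hr ▸ mem_range_self t
  have cW : ∀ t, c t ∈ W := fun t => hcl.frontier_subset (cf t)
  have hae : ∀ᵐ t, DifferentiableAt ℝ c t := hl.ae_differentiableAt
  have e1 : ∫ t in (0:ℝ)..2 * π, |dt (deriv c t) φ| = ∫ t in (0:ℝ)..2 * π, |deriv (fun t => dt (c t) φ) t| := by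
    apply intervalIntegral.integral_congr_ae
    filter_upwards [hae] with t ht _
    rw [(dt_hd ht.hasDerivAt φ).deriv]
  rw [e1]
  obtain ⟨t0, ht0⟩ := fr (φ + π)
  rw [dt_pi] at ht0
  obtain ⟨t1', ht1'⟩ := fr φ
  obtain ⟨t1, ht1m, ht1e⟩ := hp.exists_mem_Ico (by positivity) t1' t0
  rw [ht1e] at ht1'
  have k1 := int_lt hs hw0 φ
  have k2 := int_lt hs hw0 (φ + π)
  rw [dt_pi] at k2
  have hne : t0 ≠ t1 := by rintro rfl; linarith
  have ul : LipschitzWith (2 * C) (fun t => dt (c t) φ) := by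
    apply LipschitzWith.of_dist_le_mul
    intro x y
    rw [Real.dist_eq, ← dt_sub]
    refine (dt_norm _ _).trans ?_
    rw [← dist_eq_norm]
    have := hl.dist_le_mul x y
    push_cast; linarith
  have := updown (u := fun t => dt (c t) φ) (m := - h (φ + π)) (M := h φ) (t0 := t0) (t1 := t1) ul
    (fun t => by simp only [hp t])
    (fun t => by have := (hs (φ + π)).2 _ (cW t); rw [dt_pi] at this; linarith) (fun t => (hs φ).2 _ (cW t))
    (by linarith) ht1' (lt_of_le_of_ne ht1m.1 hne) ht1m.2 ?_
  · rw [this]; ring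
  intro x y z hxy hyz hzx e1 e2 hm hM
  obtain ⟨w, hw, ew⟩ : ∃ w ∈ interior W, dt w φ = dt (c y) φ := by
    rcases lt_trichotomy (dt w0 φ) (dt (c y) φ) with h | h | h
    · exact level_int hcv hw0 (cW t1) (Or.inl ⟨h, by rw [ht1']; exact hM⟩)
    · exact ⟨w0, hw0, h⟩
    · exact level_int hcv hw0 (cW t0) (Or.inr ⟨by linarith, h⟩)
  have n1 := neg2 hcv hcl hw (cf x) (cf y) (by rw [e1, ew]) ew.symm (inj_window hp hi hxy (by linarith))
  have n2 := neg2 hcv hcl hw (cf y) (cf z) ew.symm (by rw [← e2, ew]) (inj_window hp hi hyz (by linarith))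
  have n3 := neg2 hcv hcl hw (cf x) (cf z) (by rw [e1, ew]) (by rw [← e2, ew])
    (inj_window hp hi (hxy.trans hyz) hzx)
  have := mul_pos_of_neg_of_neg n1 n2
  nlinarith [sq_nonneg (dt (c y - w) (φ + π / 2)), mul_nonneg (sq_nonneg (dt (c y - w) (φ + π / 2))) (neg_nonneg.2 n3.le)]

end part6

section part7
open Filter Topology

lemma length_eq {a : ℝ → ℝ} (ha : Nice a) (hpos : ∀ θ, 0 < a θ) (hra : ∀ θ, 0 ≤ rho a θ)
    (hsy : ∀ θ, a (θ + π) = a θ) {W : Set (ℝ × ℝ)} {h : ℝ → ℝ} {R : ℝ} (hcv : Convex ℝ W) (hcl : IsClosed W)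
    (hb : Bd R W) (hs : Supp W h)
    (hne : (interior W).Nonempty) {c : ℝ → ℝ × ℝ} (hp : Function.Periodic c (2 * π)) (hr : range c = frontier W)
    {C : NNReal} (hl : LipschitzWith C c) (hi : InjOn c (Ico 0 (2 * π))) :
    ∫ t in (0:ℝ)..2 * π, gauge (convexHull ℝ (range fun θ => (a θ)⁻¹ • eth θ)) (deriv c t) =
      ∫ θ in (0:ℝ)..2 * π, h θ * rho a θ := by
  have hrc := rho_cont ha
  have hhc := hs.cont hb
  have h2p : (0:ℝ) ≤ 2 * π := by positivity
  simp only [gauge_int ha hpos hra hsy]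
  rw [intervalIntegral.integral_const_mul]
  obtain ⟨B, hB0, hB⟩ := per_bdd hrc (rho_per ha)
  have sw : ∫ t in (0:ℝ)..2 * π, ∫ φ in (0:ℝ)..2 * π, |dt (deriv c t) φ| * rho a φ =
      ∫ φ in (0:ℝ)..2 * π, ∫ t in (0:ℝ)..2 * π, |dt (deriv c t) φ| * rho a φ := by
    simp only [intervalIntegral.integral_of_le h2p]
    apply integral_integral_swap
    apply Integrable.mono' (g := fun _ => 2 * C * B) (integrable_const _)
    · apply Measurable.aestronglyMeasurable
      have m1 : Measurable fun z : ℝ × ℝ => deriv c z.1 := (measurable_deriv c).comp measurable_fst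
      have m2 : Measurable fun z : ℝ × ℝ => dt (deriv c z.1) z.2 := by
        unfold dt
        exact (m1.fst.mul (measurable_cos.comp measurable_snd)).add (m1.snd.mul (measurable_sin.comp measurable_snd))
      exact m2.abs.mul (hrc.measurable.comp measurable_snd)
    · refine Eventually.of_forall fun z => ?_
      simp only [Function.uncurry, norm_mul, Real.norm_eq_abs, abs_abs]
      have h1 := dt_norm (deriv c z.1) z.2
      have h2 := norm_deriv_le_of_lipschitz (x₀ := z.1) hl
      have h3 := hB z.2
      gcongr
      linarith
  rw [sw]
  have e1 : ∀ φ, ∫ t in (0:ℝ)..2 * π, |dt (deriv c t) φ| * rho a φ = 2 * (h φ * rho a φ + h (φ + π) * rho a (φ + π)) := by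
    intro φ
    rw [intervalIntegral.integral_mul_const, width hcv hcl hs hne hp hr hl hi, rho_pi hsy]; ring
  simp only [e1]
  rw [intervalIntegral.integral_const_mul, intervalIntegral.integral_add
    (Continuous.intervalIntegrable (by fun_prop) _ _) (Continuous.intervalIntegrable (by fun_prop) _ _)]
  have pf : Function.Periodic (fun φ => h φ * rho a φ) (2 * π) := by
    intro φ; simp only [hs.per φ, rho_per ha φ]
  have := per_shift pf π
  rw [this]; ring

theorem fin_thm (a : ℝ → ℝ) (ha : ContDiff ℝ (⊤ : ℕ∞) a) (haper : Function.Periodic a (2 * π))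
    (hapos : ∀ θ, 0 < a θ) (hconv : ∀ θ, 0 < a θ + deriv (deriv a) θ)
    (p : ℝ → ℝ × ℝ) (hp : ∀ θ, p θ = a θ • er θ + deriv a θ • eth θ)
    (q : ℝ → ℝ × ℝ) (hq : ∀ θ, q θ = (det2 (p θ) (deriv p θ))⁻¹ • deriv p θ)
    (hasym : ∀ θ, a (θ + π) = a θ)
    (γ : ℝ → ℝ × ℝ) (hγ : ContDiff ℝ (⊤ : ℕ∞) γ) (hγper : Function.Periodic γ (2 * π))
    (μ : ℝ → ℝ) (hμpos : ∀ θ, 0 < μ θ)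
    (hγd : ∀ θ, deriv γ θ = (μ θ * det2 (p θ) (deriv p θ)) • q θ)
    (K PB QB : Set (ℝ × ℝ)) (hK : K = convexHull ℝ (Set.range γ))
    (hPB : PB = convexHull ℝ (Set.range p)) (hQB : QB = convexHull ℝ (Set.range q))
    (rin : ℝ) (hrin : rin = sSup {r : ℝ | 0 ≤ r ∧ ∃ x : ℝ × ℝ, (fun y => x + r • y) '' PB ⊆ K})
    (D : ℝ → Set (ℝ × ℝ))
    (hD : ∀ r, D r = {x ∈ K | ∀ y ∈ Set.range γ, r ≤ gauge PB (x - y)})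
    (LQr : ℝ → ℝ)
    (hLQr : ∀ r ∈ Set.Ico (0:ℝ) rin, ∃ c : ℝ → ℝ × ℝ,
      Function.Periodic c (2 * π) ∧ Set.range c = frontier (D r) ∧
      (∃ M : NNReal, LipschitzWith M c) ∧ Set.InjOn c (Set.Ico 0 (2 * π)) ∧
      LQr r = ∫ θ in (0:ℝ)..2 * π, gauge QB (deriv c θ))
    (A : ℝ) (hA : A = (1 / 2) * ∫ θ in (0:ℝ)..2 * π, det2 (γ θ) (deriv γ θ)) :
    A = ∫ r in (0:ℝ)..rin, LQr r := by
  have hna : Nice a := ⟨ha, haper⟩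
  have hra : ∀ θ, 0 < rho a θ := hconv
  have hra' : ∀ θ, 0 ≤ rho a θ := fun θ => (hra θ).le
  have ep : p = crv a := funext hp
  have dp : ∀ θ, deriv p θ = rho a θ • eth θ := fun θ => by rw [ep]; exact (crv_hd hna θ).deriv
  have dd : ∀ θ, det2 (p θ) (deriv p θ) = rho a θ * a θ := fun θ => by
    rw [dp, det2_smul, ep, det2_crv, dt_crv]
  have eq : q = fun θ => (a θ)⁻¹ • eth θ := by
    ext1 θ
    have := (hra θ).ne'
    have := (hapos θ).ne'
    rw [hq, dd, dp, smul_smul]; congr 1; field_simp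
  have dγ : ∀ θ, deriv γ θ = (μ θ * rho a θ) • eth θ := by
    intro θ
    have := (hapos θ).ne'
    rw [hγd, dd, eq, smul_smul]; congr 1; field_simp
  have hdγ : ∀ θ, HasDerivAt γ ((μ θ * rho a θ) • eth θ) θ := fun θ => by
    rw [← dγ]; exact ((hγ.differentiable (by simp)) θ).hasDerivAt
  set g : ℝ → ℝ := fun θ => dt (γ θ) θ with hg
  have hng : Nice g := by
    refine ⟨?_, fun θ => ?_⟩
    · simp only [hg, dt]
      exact ((contDiff_fst.comp hγ).mul contDiff_cos).add ((contDiff_snd.comp hγ).mul contDiff_sin)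
    · simp only [hg, hγper θ]; exact dt_per _ θ
  have h1 : ∀ θ, HasDerivAt (fun t => (γ t).1) (-(μ θ * rho a θ * sin θ)) θ := by
    intro θ
    have := (hasFDerivAt_fst (𝕜 := ℝ) (p := γ θ)).comp_hasDerivAt θ (hdγ θ)
    refine HasDerivAt.congr_deriv this ?_
    simp [eth]
  have h2 : ∀ θ, HasDerivAt (fun t => (γ t).2) (μ θ * rho a θ * cos θ) θ := by
    intro θ
    have := (hasFDerivAt_snd (𝕜 := ℝ) (p := γ θ)).comp_hasDerivAt θ (hdγ θ)
    refine HasDerivAt.congr_deriv this ?_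
    simp [eth]
  have dg : deriv g = fun θ => (γ θ).1 * (- sin θ) + (γ θ).2 * cos θ := by
    ext1 θ
    have := ((h1 θ).mul (hasDerivAt_cos θ)).add ((h2 θ).mul (hasDerivAt_sin θ))
    have : HasDerivAt g _ θ := this
    rw [this.deriv]; ring
  have rg : ∀ θ, rho g θ = μ θ * rho a θ := by
    intro θ
    have := ((h1 θ).mul (hasDerivAt_sin θ).neg).add ((h2 θ).mul (hasDerivAt_cos θ))
    have h3 : HasDerivAt (fun θ => (γ θ).1 * (- sin θ) + (γ θ).2 * cos θ) _ θ := this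
    rw [rho, dg, h3.deriv]; simp only [hg, dt, Pi.neg_apply]
    linear_combination (μ θ * rho a θ) * sin_sq_add_cos_sq θ
  have hrg : ∀ θ, 0 ≤ rho g θ := fun θ => by rw [rg]; exact mul_nonneg (hμpos θ).le (hra' θ)
  have eγ : γ = crv g := by
    ext1 θ
    have hcs := sin_sq_add_cos_sq θ
    rw [crv, dg]
    simp only [hg, dt]
    ext
    · simp [er, eth]; linear_combination (-(γ θ).1) * hcs
    · simp [er, eth]; linear_combination (-(γ θ).2) * hcs
  have hPB' : PB = Wu a := by rw [hPB, ep]; exact hull_eq hna hra'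
  have hK' : K = Wu g := by rw [hK, eγ]; exact hull_eq hng hrg
  have hgs := wu_supp hng hrg
  have hrin' : rin = sSup (Rset g a) := by
    rw [hrin, hPB', hK', rset_eq hna hra']
  have hA' : A = (1 / 2) * ∫ θ in (0:ℝ)..2 * π, g θ * rho g θ := by
    rw [hA]; congr 1
    apply intervalIntegral.integral_congr
    intro θ _
    simp only
    rw [dγ, ← rg, det2_smul, mul_comm]
    congr 1
    rw [eγ, det2_crv, dt_crv]
  obtain ⟨L, hL, hLi⟩ := core hng hna hapos hgs
  rw [hA', hLi, ← hrin']
  obtain ⟨hr0, x0, hx0⟩ := rset_mem hng hapos hgs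
  rw [← hrin'] at hr0 hx0
  rw [← hrin'] at hL
  apply intervalIntegral.integral_congr_Ioo_of_le hr0
  intro r hr
  obtain ⟨c, cp, cr, ⟨M, cl⟩, ci, ce⟩ := hLQr r ⟨hr.1.le, hr.2⟩
  have hDr : D r = Wu (kr g a r) := by
    rw [hD, hK', hPB', eγ]; exact inner_eq hng hna hapos hra' hasym hr.1.le
  have hint : (interior (Wu (kr g a r))).Nonempty := by
    refine ⟨x0, wu_interior hna hapos (s := rin - r) (by linarith [hr.2]) fun θ => ?_⟩
    have := hx0 θ
    simp only [kr] at this ⊢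
    linarith
  obtain ⟨R, -, hR⟩ := wu_bd (kr_nice hng hna r)
  obtain ⟨h, hs⟩ := exists_supp (bd_compact (wu_closed _) hR) (hint.mono interior_subset)
  rw [hL r ⟨hr.1.le, hr.2.le⟩ h hs, ce, hQB, eq]
  rw [hDr] at cr
  exact (length_eq hna hapos hra' hasym (wu_convex _) (wu_closed _) hR hs hint cp cr cl ci).symm

end part7

/-- The area enclosed by a convex curve is the integral of the Minkowski
lengths of its inner parallel curves. -/
theorem stmt12 (a : ℝ → ℝ) (ha : ContDiff ℝ (⊤ : ℕ∞) a) (haper : Function.Periodic a (2 * π))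
    (hapos : ∀ θ, 0 < a θ) (hconv : ∀ θ, 0 < a θ + deriv (deriv a) θ)
    (p : ℝ → ℝ × ℝ) (hp : ∀ θ, p θ = a θ • er θ + deriv a θ • eth θ)
    (q : ℝ → ℝ × ℝ) (hq : ∀ θ, q θ = (det2 (p θ) (deriv p θ))⁻¹ • deriv p θ)
    (hasym : ∀ θ, a (θ + π) = a θ)
    (γ : ℝ → ℝ × ℝ) (hγ : ContDiff ℝ (⊤ : ℕ∞) γ) (hγper : Function.Periodic γ (2 * π))
    (μ : ℝ → ℝ) (hμpos : ∀ θ, 0 < μ θ) (hμcont : Continuous μ)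
    (hγd : ∀ θ, deriv γ θ = (μ θ * det2 (p θ) (deriv p θ)) • q θ)
    (hsimple : Set.InjOn γ (Set.Ico 0 (2 * π)))
    (K PB QB : Set (ℝ × ℝ)) (hK : K = convexHull ℝ (Set.range γ))
    (hPB : PB = convexHull ℝ (Set.range p)) (hQB : QB = convexHull ℝ (Set.range q))
    (rin : ℝ) (hrin : rin = sSup {r : ℝ | 0 ≤ r ∧ ∃ x : ℝ × ℝ, (fun y => x + r • y) '' PB ⊆ K})
    (D : ℝ → Set (ℝ × ℝ))
    (hD : ∀ r, D r = {x ∈ K | ∀ y ∈ Set.range γ, r ≤ gauge PB (x - y)})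
    (LQr : ℝ → ℝ)
    (hLQr : ∀ r ∈ Set.Ico (0:ℝ) rin, ∃ c : ℝ → ℝ × ℝ,
      Function.Periodic c (2 * π) ∧ Set.range c = frontier (D r) ∧
      (∃ M : NNReal, LipschitzWith M c) ∧ Set.InjOn c (Set.Ico 0 (2 * π)) ∧
      LQr r = ∫ θ in (0:ℝ)..2 * π, gauge QB (deriv c θ))
    (A : ℝ) (hA : A = (1 / 2) * ∫ θ in (0:ℝ)..2 * π, det2 (γ θ) (deriv γ θ)) :
    A = ∫ r in (0:ℝ)..rin, LQr r := by
  exact fin_thm a ha haper hapos hconv p hp q hq hasym γ hγ hγper μ hμpos hγd K PB QB hK hPB hQB rin hrin D hD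
    LQr hLQr A hA

end
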